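/- arXiv:1411.1546 — 3 statements merged into one kernel-verified Lean document; each statement's English description precedes it below -/
import Mathlib

section
/- Let ({X_i}, T) be an atomic tree decomposition of a finite connected graph G, let e = (s,t) be any edge of T, let T_t be the connected component of T − e containing t, let G_t be the subgraph of G induced by ∪_{u ∈ T_t} X_u, and set X = X_s ∩ X_t. Then there exists a connected component C_t of G_t − X such that the neighborhood of C_t in G is exactly X and X_t ⊆ C_t ∪ X. -/
open SimpleGraph
/-- A tree decomposition of a graph `G` with index type `ι`. -/
structure TreeDecomp {V : Type} (G : SimpleGraph V) (ι : Type) where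
  tree : SimpleGraph ι
  isTree : tree.IsTree
  bag : ι → Set V
  covers : ∀ v : V, ∃ i, v ∈ bag i
  coversEdge : ∀ ⦃v w : V⦄, G.Adj v w → ∃ i, v ∈ bag i ∧ w ∈ bag i
  bagConn : ∀ v : V, (tree.induce {i | v ∈ bag i}).Connected

namespace TreeDecomp

variable {V ι : Type} {G : SimpleGraph V}

noncomputable def width (D : TreeDecomp G ι) : ℕ :=
  sSup {n | ∃ i, (D.bag i).ncard = n} - 1

noncomputable def length (D : TreeDecomp G ι) : ℕ :=
  sSup {d | ∃ i x y, x ∈ D.bag i ∧ y ∈ D.bag i ∧ G.dist x y = d}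

noncomputable def fatness [Fintype V] (D : TreeDecomp G ι) :
    Fin (Fintype.card V + 1) → ℕ :=
  fun h => {i | (D.bag i).ncard = Fintype.card V - (h : ℕ)}.ncard

end TreeDecomp

/-- Lexicographic comparison of tuples. -/
def FinLexLE {m : ℕ} (f g : Fin m → ℕ) : Prop :=
  f = g ∨ ∃ k, (∀ j < k, f j = g j) ∧ f k < g k

/-- An atomic tree decomposition: one of lexicographically minimal fatness. -/
def TreeDecomp.IsAtomic {V ι : Type} [Fintype V] {G : SimpleGraph V}
    (D : TreeDecomp G ι) : Prop :=
  ∀ (ι' : Type) (_ : Fintype ι') (D' : TreeDecomp G ι'), FinLexLE D.fatness D'.fatness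

noncomputable def treewidth {V : Type} (G : SimpleGraph V) : ℕ :=
  sInf {w | ∃ (ι : Type) (_ : Fintype ι) (D : TreeDecomp G ι), D.width = w}

noncomputable def treelength {V : Type} (G : SimpleGraph V) : ℕ :=
  sInf {l | ∃ (ι : Type) (_ : Fintype ι) (D : TreeDecomp G ι), D.length = l}

/-- A cycle of `G`: a connected 2-regular subgraph. -/
def IsCycleSubgraph {V : Type} {G : SimpleGraph V} (H : G.Subgraph) : Prop :=
  H.Connected ∧ ∀ v ∈ H.verts, (H.neighborSet v).ncard = 2

/-- A geodesic subgraph: distances within `H` agree with distances in `G`. -/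
def IsGeodesicSubgraph {V : Type} {G : SimpleGraph V} (H : G.Subgraph) : Prop :=
  ∀ u v : H.verts, H.coe.dist u v = G.dist (u : V) (v : V)

/-- `ν(G)`: the length (number of edges) of a longest geodesic cycle of `G`. -/
noncomputable def geodesicCycleSup {V : Type} (G : SimpleGraph V) : ℕ :=
  sSup {m | ∃ H : G.Subgraph, IsCycleSubgraph H ∧ IsGeodesicSubgraph H ∧ H.edgeSet.ncard = m}

/-- Gromov hyperbolicity via the four-point condition. -/
noncomputable def hyperbolicity {V : Type} (G : SimpleGraph V) : ℝ :=
  sInf {δ : ℝ | 0 ≤ δ ∧ ∀ w x y z : V,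
    (G.dist w x : ℝ) + (G.dist y z : ℝ) ≤
      max ((G.dist w y : ℝ) + (G.dist x z : ℝ)) ((G.dist w z : ℝ) + (G.dist x y : ℝ)) + 2 * δ}

/-- Two-connected: connected, at least three vertices, and no cut vertex. -/
def TwoConnected {V : Type} [Fintype V] (G : SimpleGraph V) : Prop :=
  G.Connected ∧ 3 ≤ Fintype.card V ∧ ∀ x : V, (G.induce {y | y ≠ x}).Connected

namespace SimpleGraph

/-- A tree, rooted at any vertex `r`, has a parent function. -/
theorem IsTree.exists_parent {ι : Type} {T : SimpleGraph ι} (hT : T.IsTree) (r : ι) :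
    ∃ p : ι → ι, (∀ x, x ≠ r → T.Adj x (p x) ∧ T.dist (p x) r < T.dist x r) ∧
      ∀ x y, T.Adj x y → (x ≠ r ∧ p x = y) ∨ (y ≠ r ∧ p y = x) := by
  have hex : ∀ x, ∃ y, x ≠ r → T.Adj x y ∧ T.dist y r < T.dist x r := by
    intro x
    by_cases hx : x = r
    · exact ⟨x, fun h => absurd hx h⟩
    obtain ⟨w, hw⟩ := hT.connected.exists_walk_length_eq_dist x r
    cases w with
    | nil => exact absurd rfl hx
    | cons h q =>
      refine ⟨_, fun _ => ⟨h, ?_⟩⟩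
      have := dist_le q
      rw [Walk.length_cons] at hw
      omega
  choose p hp using hex
  have hcloser : ∀ x y, T.Adj x y → T.dist y r < T.dist x r → p x = y := by
    intro x y hxy hlt
    have hx : x ≠ r := by
      rintro rfl
      simp at hlt
    have key : ∀ z, T.Adj x z → T.dist z r < T.dist x r →
        ∃ q : T.Walk x r, q.IsPath ∧ q.snd = z := by
      intro z hz hzlt
      obtain ⟨w, hw⟩ := hT.connected.exists_walk_length_eq_dist z r
      refine ⟨Walk.cons hz w, Walk.isPath_of_length_eq_dist _ ?_, by simp⟩
      have := dist_le (Walk.cons hz w)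
      rw [Walk.length_cons] at this ⊢
      omega
    obtain ⟨q₁, hq₁, rfl⟩ := key y hxy hlt
    obtain ⟨q₂, hq₂, h₂⟩ := key (p x) (hp x hx).1 (hp x hx).2
    rw [← h₂, (hT.existsUnique_path x r).unique hq₁ hq₂]
  refine ⟨p, hp, fun x y hxy => ?_⟩
  have hd := hT.dist_eq_dist_add_one_of_adj r hxy
  rw [dist_comm (v := x), dist_comm (v := y)] at hd
  rcases hd with hd | hd
  · refine Or.inl ⟨?_, hcloser x y hxy (by omega)⟩
    rintro rfl
    simp at hd
  · refine Or.inr ⟨?_, hcloser y x hxy.symm (by omega)⟩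
    rintro rfl
    simp at hd

/-- A connected vertex set of a rooted tree has a top vertex: it is closed under taking parents
elsewhere. -/
theorem exists_top_of_induce_connected {ι : Type} {T : SimpleGraph ι} {r : ι} {p : ι → ι}
    {d : ι → ℕ} (hp : ∀ x, x ≠ r → d (p x) < d x) (hr : ∀ x, x ≠ r → d r < d x)
    (hadj : ∀ x y, T.Adj x y → (x ≠ r ∧ p x = y) ∨ (y ≠ r ∧ p y = x))
    {S : Set ι} (hS : (T.induce S).Connected) :
    ∃ a ∈ S, ∀ x ∈ S, x ≠ a → x ≠ r ∧ p x ∈ S := by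
  obtain ⟨⟨a₀, ha₀⟩⟩ := hS.nonempty
  obtain ⟨a, ha, hmin⟩ : ∃ a ∈ S, ∀ x ∈ S, d a ≤ d x := by
    obtain ⟨a, ha, hmin⟩ := (measure d).wf.has_min S ⟨a₀, ha₀⟩
    exact ⟨a, ha, fun x hx => not_lt.mp (hmin x hx)⟩
  refine ⟨a, ha, fun x hx hxa => ⟨?_, ?_⟩⟩
  · rintro rfl
    have := hmin x hx
    have := hr a (Ne.symm hxa)
    omega
  by_contra hpx
  have hdesc : ∀ z : S, Relation.ReflTransGen (fun z w => w ≠ r ∧ p w = z) x z.1 := by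
    intro z
    have hz := (reachable_iff_reflTransGen _ _).mp (hS.preconnected ⟨x, hx⟩ z)
    induction hz with
    | refl => exact .refl
    | @tail z w _ hzw ih =>
      have hzw' : T.Adj z.1 w.1 := hzw
      rcases hadj _ _ hzw' with ⟨_, h⟩ | h
      · rcases Relation.ReflTransGen.cases_tail ih with h' | ⟨y, hy, _, hyz⟩
        · rw [h'] at h
          exact absurd (h ▸ w.2) hpx
        · rwa [← h, hyz]
      · exact ih.tail h
  have hle : ∀ z, Relation.ReflTransGen (fun z w => w ≠ r ∧ p w = z) x z →
      z = x ∨ d x < d z := by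
    intro z hz
    induction hz with
    | refl => exact .inl rfl
    | tail _ h ih =>
      have := hp _ h.1
      rw [h.2] at this
      rcases ih with rfl | ih
      · exact .inr this
      · exact .inr (ih.trans this)
  rcases hle a (hdesc ⟨a, ha⟩) with h | h
  · exact hxa h.symm
  · exact absurd (hmin x hx) (not_le.mpr h)

/-- The graph of a parent function. -/
def parentGraph {ι : Type} (p : ι → ι) : SimpleGraph ι := fromRel fun x y => p x = y

theorem parentGraph_induce_connected {ι : Type} {p : ι → ι} {d : ι → ℕ} {S : Set ι} {a : ι}
    (ha : a ∈ S) (h : ∀ x ∈ S, x ≠ a → d (p x) < d x ∧ p x ∈ S) :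
    ((parentGraph p).induce S).Connected := by
  have hreach : ∀ n (x : S), d x = n → ((parentGraph p).induce S).Reachable x ⟨a, ha⟩ := by
    intro n
    induction n using Nat.strong_induction_on with
    | _ n ih =>
      rintro ⟨x, hx⟩ rfl
      by_cases hxa : x = a
      · subst hxa
        rfl
      obtain ⟨hd, hpS⟩ := h x hx hxa
      refine Reachable.trans (Adj.reachable ?_) (ih _ hd ⟨p x, hpS⟩ rfl)
      simp only [comap_adj, parentGraph, fromRel_adj]
      refine ⟨fun he => ?_, .inl rfl⟩
      simp only [Function.Embedding.subtype_apply] at he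
      rw [← he] at hd
      exact lt_irrefl _ hd
  have : Nonempty S := ⟨⟨a, ha⟩⟩
  exact ⟨fun x y => (hreach _ x rfl).trans (hreach _ y rfl).symm⟩

theorem parentGraph_isTree {ι : Type} [Finite ι] {p : ι → ι} {d : ι → ℕ} (r : ι)
    (h : ∀ x, x ≠ r → d (p x) < d x) (hr : p r = r) : (parentGraph p).IsTree := by
  have hconn : (parentGraph p).Connected := by
    have := parentGraph_induce_connected (p := p) (d := d) (S := Set.univ) (Set.mem_univ r)
      fun x _ hx => ⟨h x hx, Set.mem_univ _⟩
    exact (induceUnivIso _).connected_iff.mp this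
  refine isTree_iff_connected_and_card.mpr ⟨hconn, le_antisymm ?_
    hconn.card_vert_le_card_edgeSet_add_one⟩
  have hsub : (parentGraph p).edgeSet ⊆ (fun x => s(x, p x)) '' {r}ᶜ := by
    intro e
    induction e with
    | _ x y =>
      intro hxy
      obtain ⟨hne, hxy | hxy⟩ := (fromRel_adj _ _ _).mp ((mem_edgeSet _).mp hxy)
      · refine ⟨x, ?_, by rw [← hxy]⟩
        rintro rfl
        exact hne (hr.symm.trans hxy)
      · refine ⟨y, ?_, by rw [← hxy]; exact Sym2.eq_swap⟩
        rintro rfl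
        exact hne (hxy.symm.trans hr)
  have h₁ := (Set.ncard_le_ncard hsub (Set.toFinite _)).trans
    (Set.ncard_image_le (Set.toFinite _))
  have h₂ := Set.ncard_add_ncard_compl ({r} : Set ι)
  rw [Set.ncard_singleton] at h₂
  rw [Nat.card_coe_set_eq]
  omega

end SimpleGraph

namespace TreeDecomp

variable {V ι ι' : Type} {G : SimpleGraph V}

/-- A tree decomposition given by a rooted tree. -/
def ofParent [Finite ι] (r : ι) (p : ι → ι) (d : ι → ℕ) (bag : ι → Set V)
    (hd : ∀ x, x ≠ r → d (p x) < d x) (hr : p r = r)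
    (hbag : ∀ v, ∃ a, v ∈ bag a ∧ ∀ x, v ∈ bag x → x ≠ a → x ≠ r ∧ v ∈ bag (p x))
    (hedge : ∀ ⦃v w : V⦄, G.Adj v w → ∃ i, v ∈ bag i ∧ w ∈ bag i) : TreeDecomp G ι where
  tree := parentGraph p
  isTree := parentGraph_isTree r hd hr
  bag := bag
  covers v := (hbag v).imp fun _ h => h.1
  coversEdge := hedge
  bagConn v := by
    obtain ⟨a, ha, h⟩ := hbag v
    exact parentGraph_induce_connected (d := d) (S := {i | v ∈ bag i}) ha
      fun x hx hxa => ⟨hd x (h x hx hxa).1, (h x hx hxa).2⟩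

/-- A decomposition is not atomic if another one has, among its bags of size at least `k`,
fewer bags of size `k` and no more bags of any larger size. -/
theorem not_isAtomic_of_injOn [Fintype V] [Fintype ι] [Fintype ι'] (D : TreeDecomp G ι)
    (D' : TreeDecomp G ι') (k : ℕ) (f : ι' → ι)
    (hf : ∀ x, k ≤ (D'.bag x).ncard → (D'.bag x).ncard = (D.bag (f x)).ncard)
    (hinj : Set.InjOn f {x | k ≤ (D'.bag x).ncard})
    (u : ι) (hu : (D.bag u).ncard = k) (hne : ∀ x, k ≤ (D'.bag x).ncard → f x ≠ u) :
    ¬ D.IsAtomic := by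
  intro hD
  have hk : k ≤ Fintype.card V := by
    rw [← hu, ← Nat.card_eq_fintype_card]
    exact Set.ncard_le_card _
  have hle : ∀ m, k ≤ m → {i | (D'.bag i).ncard = m}.ncard ≤ {i | (D.bag i).ncard = m}.ncard := by
    intro m hm
    refine Set.ncard_le_ncard_of_injOn f ?_ (hinj.mono ?_) (Set.toFinite _)
    · rintro x rfl
      exact (hf x hm).symm
    · rintro x rfl
      exact hm
  have hlt : {i | (D'.bag i).ncard = k}.ncard < {i | (D.bag i).ncard = k}.ncard := by
    refine lt_of_le_of_lt ?_ (Set.ncard_sdiff_singleton_lt_of_mem (a := u) hu (Set.toFinite _))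
    refine Set.ncard_le_ncard_of_injOn f ?_ (hinj.mono ?_) (Set.toFinite _)
    · intro x hx
      have hx' : k ≤ (D'.bag x).ncard := le_of_eq (Eq.symm hx)
      exact ⟨(hf x hx').symm.trans hx, hne x hx'⟩
    · intro x hx
      exact le_of_eq (Eq.symm hx)
  let j₀ : Fin (Fintype.card V + 1) := ⟨Fintype.card V - k, by omega⟩
  have hj₀ : D'.fatness j₀ < D.fatness j₀ := by
    simp only [fatness, j₀, Nat.sub_sub_self hk]
    exact hlt
  rcases hD ι' inferInstance D' with h | ⟨j, hj, hjlt⟩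
  · rw [h] at hj₀
    exact lt_irrefl _ hj₀
  · by_cases hjj : j₀ < j
    · rw [hj _ hjj] at hj₀
      exact lt_irrefl _ hj₀
    · have : (j : ℕ) ≤ Fintype.card V - k := not_lt.mp hjj
      exact absurd hjlt (not_lt.mpr (hle _ (by omega)))

/-- Every rooting of a tree decomposition has a parent function, and the bags holding a given vertex
are closed under taking parents, except at a single top bag. -/
theorem exists_parent (D : TreeDecomp G ι) (r : ι) :
    ∃ p : ι → ι, p r = r ∧ (∀ x, D.tree.Adj x r → p x = r) ∧
      (∀ x, x ≠ r → D.tree.Adj x (p x)) ∧ (∀ x, x ≠ r → D.tree.dist (p x) r < D.tree.dist x r) ∧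
      ∀ v, ∃ a, v ∈ D.bag a ∧ ∀ x, v ∈ D.bag x → x ≠ a → x ≠ r ∧ v ∈ D.bag (p x) := by
  classical
  obtain ⟨p, hp, hadj⟩ := D.isTree.exists_parent r
  refine ⟨Function.update p r r, by simp, fun x hx => ?_,
    fun x hx => by simpa [hx] using (hp x hx).1, fun x hx => by simpa [hx] using (hp x hx).2, fun v => ?_⟩
  · obtain ⟨h, h'⟩ | ⟨h, -⟩ := hadj x r hx
    · simpa [h] using h'
    · exact absurd rfl h
  obtain ⟨a, ha, h⟩ := exists_top_of_induce_connected (d := fun x => D.tree.dist x r)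
    (fun x hx => (hp x hx).2)
    (fun x hx => by simpa using D.isTree.connected.pos_dist_of_ne hx) hadj (D.bagConn v)
  refine ⟨a, ha, fun x hx hxa => ?_⟩
  obtain ⟨hxr, hpx⟩ := h x hx hxa
  exact ⟨hxr, by simpa [hxr] using hpx⟩

/-- The bags of an atomic tree decomposition form an antichain. -/
theorem IsAtomic.not_bag_subset [Fintype V] [Fintype ι] {D : TreeDecomp G ι} (hD : D.IsAtomic)
    {s r : ι} (hsr : s ≠ r) : ¬ D.bag s ⊆ D.bag r := by
  classical
  intro hsub
  obtain ⟨p, hpr, -, -, hd, hbag⟩ := D.exists_parent r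
  let p' : {x // x ≠ s} → {x // x ≠ s} := fun x =>
    if h : p x = s then ⟨r, hsr.symm⟩ else ⟨p x, h⟩
  let D' : TreeDecomp G {x // x ≠ s} := ofParent ⟨r, hsr.symm⟩ p' (fun x => D.tree.dist x r)
    (fun x => D.bag x)
    (by
      intro x hx
      have hx' : x.1 ≠ r := fun h => hx (Subtype.ext h)
      by_cases h : p x = s
      · simpa [p', h] using D.isTree.connected.pos_dist_of_ne hx'
      · simpa [p', h] using hd x hx')
    (by simp [p', hpr, hsr.symm])
    (by
      intro v
      obtain ⟨a, ha, h⟩ := hbag v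
      have has : a ≠ s := by
        rintro rfl
        exact (h r (hsub ha) hsr.symm).1 rfl
      refine ⟨⟨a, has⟩, ha, fun x hx hxa => ?_⟩
      obtain ⟨hxr, hpx⟩ := h x hx fun h => hxa (Subtype.ext h)
      refine ⟨fun h => hxr (congrArg Subtype.val h), ?_⟩
      by_cases h : p x = s
      · simpa [p', h] using hsub (h ▸ hpx)
      · simpa [p', h] using hpx)
    (by
      intro v w hvw
      obtain ⟨i, hv, hw⟩ := D.coversEdge hvw
      by_cases h : i = s
      · subst h
        exact ⟨⟨r, hsr.symm⟩, hsub hv, hsub hw⟩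
      · exact ⟨⟨i, h⟩, hv, hw⟩)
  exact D.not_isAtomic_of_injOn D' _ Subtype.val (fun _ _ => rfl)
    Subtype.val_injective.injOn s rfl (fun x _ => x.2) hD

/-- A vertex in bags on both sides of an edge of the tree lies in both of its endpoints' bags. -/
theorem mem_inter_of_not_reachable (D : TreeDecomp G ι) {s t u w : ι} {v : V}
    (hu : v ∈ D.bag u) (hw : v ∈ D.bag w)
    (huw : ¬ (D.tree.deleteEdges {s(s, t)}).Reachable u w) : v ∈ D.bag s ∩ D.bag t := by
  by_contra hv
  let φ : D.tree.induce {i | v ∈ D.bag i} →g D.tree.deleteEdges {s(s, t)} :=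
    ⟨Subtype.val, by
      rintro ⟨a, ha⟩ ⟨b, hb⟩ hab
      simp only [deleteEdges_adj, Set.mem_singleton_iff]
      refine ⟨hab, fun h => hv ?_⟩
      rcases Sym2.eq_iff.mp h with ⟨rfl, rfl⟩ | ⟨rfl, rfl⟩
      · exact ⟨ha, hb⟩
      · exact ⟨hb, ha⟩⟩
  exact huw (((D.bagConn v).preconnected ⟨u, hu⟩ ⟨w, hw⟩).map φ)

/-- If the part of an atomic tree decomposition beyond the edge `s t` is covered by pieces meeting
only in the adhesion set of that edge, then the bag of `t` lies in a single piece. -/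
theorem IsAtomic.exists_bag_subset [Fintype V] [Fintype ι] {D : TreeDecomp G ι} (hD : D.IsAtomic)
    {s t : ι} (hst : D.tree.Adj s t) {K : Type} [Finite K] (B : K → Set V)
    (hmeet : ∀ k l, k ≠ l → B k ∩ B l ⊆ D.bag s ∩ D.bag t)
    (hB : ∀ u v, (D.tree.deleteEdges {s(s, t)}).Reachable t u → v ∈ D.bag u →
      v ∉ D.bag s ∩ D.bag t → ∃ k, v ∈ B k ∧ ∀ w, G.Adj v w → w ∈ B k) :
    ∃ k, D.bag t ⊆ B k := by
  classical
  by_contra! hnone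
  set A : ι → Prop := fun u => (D.tree.deleteEdges {s(s, t)}).Reachable t u
  obtain ⟨p, -, hps, hadj, hd, hbag⟩ := D.exists_parent s
  have hAt : A t := Reachable.refl t
  have hAs : ¬ A s := fun h =>
    isBridge_iff.mp (isAcyclic_iff_forall_adj_isBridge.mp D.isTree.isAcyclic hst) h.symm
  have hAp : ∀ u, u ≠ s → u ≠ t → (A u ↔ A (p u)) := by
    intro u hus hut
    have : (D.tree.deleteEdges {s(s, t)}).Adj u (p u) := by
      simp only [deleteEdges_adj, Set.mem_singleton_iff]
      refine ⟨hadj u hus, fun h => ?_⟩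
      rcases Sym2.eq_iff.mp h with ⟨h, -⟩ | ⟨h, -⟩
      · exact hus h
      · exact hut h
    exact ⟨fun h => h.trans this.reachable, fun h => h.trans this.reachable.symm⟩
  have hsides : ∀ v u w, v ∈ D.bag u → v ∈ D.bag w → v ∉ D.bag s ∩ D.bag t → (A u ↔ A w) := by
    intro v u w hu hw hv
    have := not_not.mp (mt (D.mem_inter_of_not_reachable hu hw) hv)
    exact ⟨fun h => h.trans this, fun h => h.trans this.symm⟩
  let J := {x : ι × Option K // A x.1 ↔ x.2.isSome}
  have : Fintype J := Fintype.ofFinite J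
  let root : J := ⟨(s, none), by simpa using hAs⟩
  let p' : J → J := fun x =>
    if h : x.1.1 = s ∨ x.1.1 = t then root
    else ⟨(p x.1.1, x.1.2), (hAp _ (not_or.mp h).1 (not_or.mp h).2).symm.trans x.2⟩
  let Bo : Option K → Set V := fun o => o.elim Set.univ B
  have hroot : ∀ x : J, x.1.1 = s → x = root := by
    rintro ⟨⟨u, o⟩, h⟩ (hu : u = s)
    cases o with
    | none => exact Subtype.ext (Prod.ext hu rfl)
    | some k => exact absurd (hu ▸ h.mpr rfl) hAs
  let D' : TreeDecomp G J := ofParent root p' (fun x => D.tree.dist x.1.1 s)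
    (fun x => D.bag x.1.1 ∩ Bo x.1.2)
    (by
      intro x hx
      have hxs : x.1.1 ≠ s := fun h => hx (hroot x h)
      by_cases h : x.1.1 = t
      · simpa [p', h, root] using D.isTree.connected.pos_dist_of_ne hst.ne'
      · simpa [p', h, hxs] using hd _ hxs)
    (by simp [p', root])
    (by
      intro v
      obtain ⟨a, ha, hav⟩ := hbag v
      by_cases hv : v ∈ D.bag s ∩ D.bag t
      · have has : a = s := by
          by_contra h
          exact (hav s hv.1 (Ne.symm h)).1 rfl
        refine ⟨root, ⟨hv.1, trivial⟩, fun x hx hxr => ⟨hxr, ?_⟩⟩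
        have hxs : x.1.1 ≠ s := fun h => hxr (hroot x h)
        by_cases h : x.1.1 = t
        · simpa [p', h, root, Bo] using hv.1
        · simpa [p', h, hxs] using ⟨(hav _ hx.1 (has ▸ hxs)).2, hx.2⟩
      · obtain ⟨o, ho, hvo, huniq⟩ : ∃ o : Option K, (A a ↔ o.isSome) ∧ v ∈ Bo o ∧
            ∀ o' : Option K, (A a ↔ o'.isSome) → v ∈ Bo o' → o' = o := by
          by_cases hAa : A a
          · obtain ⟨k, hk, -⟩ := hB a v hAa ha hv
            refine ⟨some k, by simpa using hAa, hk, ?_⟩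
            rintro (_ | l) hl hvl
            · exact absurd (hl.mp hAa) (by simp)
            · by_contra hne
              exact hv (hmeet l k (fun h => hne (congrArg some h)) ⟨hvl, hk⟩)
          · refine ⟨none, by simpa using hAa, trivial, ?_⟩
            rintro (_ | l) hl hvl
            · rfl
            · exact absurd (hl.mpr rfl) hAa
        refine ⟨⟨(a, o), ho⟩, ⟨ha, hvo⟩, ?_⟩
        rintro ⟨⟨u, o'⟩, hu⟩ ⟨hvu, hvo'⟩ hne
        obtain rfl := huniq o' ((hsides v a u ha hvu hv).trans hu) hvo'
        obtain ⟨hus, hpu⟩ := hav u hvu (by rintro rfl; exact hne rfl)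
        refine ⟨fun h => hus (congrArg (fun x : J => x.1.1) h), ?_⟩
        by_cases h : u = t
        · subst h
          exact absurd ⟨hps u hst.symm ▸ hpu, hvu⟩ hv
        · simpa [p', h, hus] using ⟨hpu, hvo⟩)
    (by
      have hone : ∀ v w i, G.Adj v w → v ∈ D.bag i → w ∈ D.bag i → A i →
          v ∉ D.bag s ∩ D.bag t →
          ∃ j : J, v ∈ D.bag j.1.1 ∩ Bo j.1.2 ∧ w ∈ D.bag j.1.1 ∩ Bo j.1.2 := by
        intro v w i hvw hvi hwi hi hv
        obtain ⟨k, hvk, hk⟩ := hB i v hi hvi hv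
        exact ⟨⟨(i, some k), by simpa using hi⟩, ⟨hvi, hvk⟩, hwi, hk w hvw⟩
      intro v w hvw
      obtain ⟨i, hvi, hwi⟩ := D.coversEdge hvw
      by_cases hi : A i
      · by_cases hv : v ∈ D.bag s ∩ D.bag t
        · by_cases hw : w ∈ D.bag s ∩ D.bag t
          · exact ⟨root, ⟨hv.1, trivial⟩, hw.1, trivial⟩
          · exact (hone w v i hvw.symm hwi hvi hi hw).imp fun _ h => h.symm
        · exact hone v w i hvw hvi hwi hi hv
      · exact ⟨⟨(i, none), by simpa using hi⟩, ⟨hvi, trivial⟩, hwi, trivial⟩)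
  have hXt : (D.bag s ∩ D.bag t).ncard < (D.bag t).ncard := by
    refine Set.ncard_lt_ncard ⟨Set.inter_subset_right, fun h => ?_⟩ (Set.toFinite _)
    exact hD.not_bag_subset hst.ne' fun v hv => (h hv).1
  obtain ⟨u, ⟨hAu, hu⟩, hmax⟩ := Set.exists_max_image {u | A u ∧ ∀ k, ¬ D.bag u ⊆ B k}
    (fun u => (D.bag u).ncard) (Set.toFinite _) ⟨t, hAt, hnone⟩
  have hXu := hXt.trans_le (hmax t ⟨hAt, hnone⟩)
  have hsmall : ∀ S ⊆ D.bag s ∩ D.bag t, ¬ (D.bag u).ncard ≤ S.ncard := fun S hS h =>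
    (h.trans (Set.ncard_le_ncard hS (Set.toFinite _))).not_gt hXu
  have hfull : ∀ x : J, (D.bag u).ncard ≤ (D'.bag x).ncard → D'.bag x = D.bag x.1.1 := by
    rintro ⟨⟨w, _ | k⟩, hw⟩ hx
    · exact Set.inter_univ _
    · by_contra hne
      have hwk : ¬ D.bag w ⊆ B k := fun h => hne (Set.inter_eq_left.mpr h)
      by_cases hl : ∃ l, D.bag w ⊆ B l
      · obtain ⟨l, hl⟩ := hl
        exact hsmall _ (fun v hv => hmeet k l (by rintro rfl; exact hwk hl) ⟨hv.2, hl hv.1⟩) hx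
      · have hlt : (D.bag w ∩ B k).ncard < (D.bag w).ncard :=
          Set.ncard_lt_ncard ⟨Set.inter_subset_left, fun h => hwk fun v hv => (h hv).2⟩
            (Set.toFinite _)
        exact (hx.trans_lt hlt).not_ge (hmax w ⟨hw.mpr rfl, not_exists.mp hl⟩)
  refine D.not_isAtomic_of_injOn D' _ (fun x => x.1.1) (fun x hx => by rw [hfull x hx]) ?_ u rfl
    ?_ hD
  · rintro ⟨⟨w, o⟩, hw⟩ hx ⟨⟨w', o'⟩, hw'⟩ hx' (rfl : w = w')
    rcases o with _ | k <;> rcases o' with _ | l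
    · rfl
    · exact absurd (hw.mp (hw'.mpr rfl)) (by simp)
    · exact absurd (hw'.mp (hw.mpr rfl)) (by simp)
    · by_cases hkl : k = l
      · subst hkl
        rfl
      · refine absurd hx (hsmall _ fun v hv => hmeet k l hkl ⟨hv.2, ?_⟩)
        have hv' : v ∈ D.bag w := hv.1
        rw [← hfull _ hx'] at hv'
        exact hv'.2
  · rintro ⟨⟨w, o⟩, hw⟩ hx (rfl : w = u)
    rcases o with _ | k
    · exact absurd (hw.mp hAu) (by simp)
    · exact hu k (Set.inter_eq_left.mp (hfull _ hx))

end TreeDecomp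

/-- For an edge `(s,t)` of an atomic tree decomposition, with `G_t` the graph induced by
the bags in the component of `T - (s,t)` containing `t` and `X = X_s ∩ X_t`, there is a
connected component `C_t` of `G_t - X` with `N(C_t) = X` and `X_t ⊆ C_t ∪ X`. -/
theorem atomic_good_component {V ι : Type} [Fintype V] [Fintype ι]
    (G : SimpleGraph V) (hG : G.Connected)
    (D : TreeDecomp G ι) (hD : D.IsAtomic) (s t : ι) (hst : D.tree.Adj s t)
    (Vt X : Set V)
    (hVt : Vt = ⋃ u ∈ {u | (D.tree.deleteEdges {s(s, t)}).Reachable t u}, D.bag u)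
    (hX : X = D.bag s ∩ D.bag t) :
    ∃ c : (G.induce (Vt \ X)).ConnectedComponent,
      {v : V | v ∉ Subtype.val '' c.supp ∧ ∃ w ∈ Subtype.val '' c.supp, G.Adj v w} = X ∧
      D.bag t ⊆ Subtype.val '' c.supp ∪ X := by
  classical
  subst hVt hX
  set Vt := ⋃ u ∈ {u | (D.tree.deleteEdges {s(s, t)}).Reachable t u}, D.bag u
  set X := D.bag s ∩ D.bag t
  have hmemVt : ∀ v u, (D.tree.deleteEdges {s(s, t)}).Reachable t u → v ∈ D.bag u → v ∈ Vt :=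
    fun v u hu hv => Set.mem_biUnion (x := u) hu hv
  let C : (G.induce (Vt \ X)).ConnectedComponent → Set V := fun c => Subtype.val '' c.supp
  let N : (G.induce (Vt \ X)).ConnectedComponent → Set V :=
    fun c => {v | v ∉ C c ∧ ∃ w ∈ C c, G.Adj v w}
  have hNX : ∀ c, N c ⊆ X := by
    rintro c v ⟨hv, w, ⟨⟨w, hw⟩, hwc, rfl⟩, hvw⟩
    by_contra hvX
    obtain ⟨u, hu, hwu⟩ := Set.mem_iUnion₂.mp hw.1
    obtain ⟨i, hvi, hwi⟩ := D.coversEdge hvw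
    have hui := not_not.mp (mt (D.mem_inter_of_not_reachable hwu hwi) hw.2)
    have hvt : v ∈ Vt \ X := ⟨hmemVt v i (hu.trans hui) hvi, hvX⟩
    refine hv ⟨⟨v, hvt⟩, ?_, rfl⟩
    rw [← (ConnectedComponent.mem_supp_iff _ _).mp hwc]
    exact ConnectedComponent.sound (Adj.reachable hvw)
  obtain ⟨c, hc⟩ := hD.exists_bag_subset hst (fun c => C c ∪ N c)
    (by
      rintro c c' hne v ⟨hv | hv, hv' | hv'⟩
      · obtain ⟨x, hx, rfl⟩ := hv
        obtain ⟨y, hy, hyx⟩ := hv'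
        obtain rfl := Subtype.ext hyx
        exact absurd (hx.symm.trans hy) hne
      · exact hNX _ hv'
      · exact hNX _ hv
      · exact hNX _ hv)
    (by
      intro u v hu hv hvX
      refine ⟨connectedComponentMk _ ⟨v, hmemVt v u hu hv, hvX⟩, .inl ⟨_, rfl, rfl⟩, ?_⟩
      intro w hvw
      by_cases hw : w ∈ C (connectedComponentMk _ ⟨v, hmemVt v u hu hv, hvX⟩)
      · exact .inl hw
      · exact .inr ⟨hw, v, ⟨_, rfl, rfl⟩, hvw.symm⟩)
  refine ⟨c, (hNX c).antisymm fun v hv => (hc hv.2).resolve_left ?_,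
    hc.trans (Set.union_subset_union_right _ (hNX c))⟩
  rintro ⟨⟨x, hx⟩, -, rfl⟩
  exact hx.2 hv
end

section
/- Let G be a finite two-connected graph (connected, at least three vertices, and no cut vertex) and let ({X_i}, T) be an atomic tree decomposition of G. For a bag X_t, let 𝒞_{X_t} be the collection of all geodesic cycles of G that contain at least one vertex of X_t. Then X_t ⊆ V(𝒞_{X_t}) and the subgraph of G induced by V(𝒞_{X_t}), the union of the vertex sets of the cycles in 𝒞_{X_t}, is connected. -/
open SimpleGraph
section OddClosedWalks

variable {V : Type} {G : SimpleGraph V}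

/-- The sum of an edge weighting along a walk. -/
def edgeWeight (g : Sym2 V → ZMod 2) {u v : V} (w : G.Walk u v) : ZMod 2 :=
  (w.edges.map g).sum

@[simp]
theorem edgeWeight_nil (g : Sym2 V → ZMod 2) (u : V) :
    edgeWeight g (Walk.nil : G.Walk u u) = 0 := rfl

@[simp]
theorem edgeWeight_cons (g : Sym2 V → ZMod 2) {u v x : V} (h : G.Adj u v) (w : G.Walk v x) :
    edgeWeight g (Walk.cons h w) = g s(u, v) + edgeWeight g w := by
  simp [edgeWeight]

@[simp]
theorem edgeWeight_append (g : Sym2 V → ZMod 2) {u v x : V} (p : G.Walk u v) (q : G.Walk v x) :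
    edgeWeight g (p.append q) = edgeWeight g p + edgeWeight g q := by
  simp [edgeWeight, Walk.edges_append]

@[simp]
theorem edgeWeight_reverse (g : Sym2 V → ZMod 2) {u v : V} (p : G.Walk u v) :
    edgeWeight g p.reverse = edgeWeight g p := by
  simp [edgeWeight, Walk.edges_reverse]

theorem edgeWeight_rotate [DecidableEq V] (g : Sym2 V → ZMod 2) {u v : V} (w : G.Walk v v)
    (h : u ∈ w.support) : edgeWeight g (w.rotate u h) = edgeWeight g w :=
  ((w.rotate_edges u h).perm.map g).sum_eq

theorem isPath_or_exists_closed_subwalk {u v : V} (p : G.Walk u v) :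
    p.IsPath ∨ ∃ (z : V) (p₁ : G.Walk u z) (c : G.Walk z z) (p₂ : G.Walk z v),
      p = p₁.append (c.append p₂) ∧ 0 < c.length := by
  classical
  induction p with
  | nil => left; simp
  | @cons u x v h p ih =>
    obtain ih | ⟨z, p₁, c, p₂, rfl, hc⟩ := ih
    · by_cases hu : u ∈ p.support
      · right
        refine ⟨u, Walk.nil, Walk.cons h (p.takeUntil u hu), p.dropUntil u hu, ?_, by simp⟩
        simp
      · left
        exact (Walk.cons_isPath_iff h p).2 ⟨ih, hu⟩
    · right
      exact ⟨z, Walk.cons h p₁, c, p₂, by simp, hc⟩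

theorem dist_coe_le_length {H : G.Subgraph} {u v : V} (q : G.Walk u v) (hq : q.toSubgraph ≤ H)
    (hu : u ∈ H.verts) (hv : v ∈ H.verts) : H.coe.dist ⟨u, hu⟩ ⟨v, hv⟩ ≤ q.length := by
  have hlen : q.mapToSubgraph.length = q.length := by
    exact (Walk.length_map _ _).symm.trans (congrArg Walk.length q.map_mapToSubgraph_hom)
  rw [← hlen, ← Walk.length_map (Subgraph.inclusion hq)]
  exact SimpleGraph.dist_le _

theorem ZMod.eq_zero_of_ne_one {a : ZMod 2} (h : a ≠ 1) : a = 0 := by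
  revert a; decide

/-- A shortest closed walk of odd weight is a cycle. -/
theorem isCycle_of_shortest_odd (g : Sym2 V → ZMod 2) {v : V} (w : G.Walk v v)
    (hw : edgeWeight g w = 1)
    (hmin : ∀ (x : V) (c : G.Walk x x), c.length < w.length → edgeWeight g c = 0) :
    w.IsCycle := by
  cases w with
  | nil => simp at hw
  | @cons _ x _ h p =>
    have hp : p.IsPath := by
      refine (isPath_or_exists_closed_subwalk p).resolve_right ?_
      rintro ⟨z, p₁, c, p₂, rfl, hc⟩
      have h₁ := hmin _ c (by simp; omega)
      have h₂ := hmin _ (Walk.cons h (p₁.append p₂)) (by simp; omega)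
      simp [h₁] at hw h₂
      simp [h₂] at hw
    refine (Walk.cons_isCycle_iff p h).2 ⟨hp, fun hmem => ?_⟩
    cases p with
    | nil => simp at hmem
    | @cons _ y _ h' p' =>
      rw [Walk.cons_isPath_iff] at hp
      rw [Walk.edges_cons, List.mem_cons] at hmem
      rcases hmem with hmem | hmem
      · have hy : y = v := by
          have := h.ne
          have := h'.ne
          grind
        subst hy
        obtain rfl := Walk.eq_nil_iff_nil.2 (Walk.isPath_iff_nil.1 hp.1)
        simp [hmem, CharTwo.add_self_eq_zero] at hw
      · exact hp.2 (p'.snd_mem_support_of_mem_edges hmem)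

/-- A shortest closed walk of odd weight traces a geodesic subgraph. -/
theorem isGeodesic_of_shortest_odd (g : Sym2 V → ZMod 2) {v : V} (w : G.Walk v v)
    (hw : edgeWeight g w = 1)
    (hmin : ∀ (x : V) (c : G.Walk x x), c.length < w.length → edgeWeight g c = 0) :
    IsGeodesicSubgraph w.toSubgraph := by
  classical
  rintro ⟨a, ha⟩ ⟨b, hb⟩
  have ha' : a ∈ w.support := w.mem_verts_toSubgraph.1 ha
  have hb' : b ∈ (w.rotate a ha').support := by
    rw [← Walk.mem_verts_toSubgraph, Walk.toSubgraph_rotate]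
    exact hb
  set w' := w.rotate a ha'
  have hsub : w'.toSubgraph = w.toSubgraph := Walk.toSubgraph_rotate _ _
  have hlen : w'.length = w.length := Walk.length_rotate _ _ _
  have hodd : edgeWeight g w' = 1 := (edgeWeight_rotate g w ha').trans hw
  have hspec := w'.take_spec hb'
  set q₁ := w'.takeUntil b hb'
  set q₂ := w'.dropUntil b hb'
  have hsub₁ : q₁.toSubgraph ≤ w.toSubgraph := by
    rw [← hsub, ← hspec, Walk.toSubgraph_append]; exact le_sup_left
  have hsub₂ : q₂.toSubgraph ≤ w.toSubgraph := by
    rw [← hsub, ← hspec, Walk.toSubgraph_append]; exact le_sup_right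
  have hlen' : q₁.length + q₂.length = w.length := by
    rw [← hlen, ← hspec, Walk.length_append]
  have hodd' : edgeWeight g q₁ + edgeWeight g q₂ = 1 := by
    rw [← hodd, ← hspec, edgeWeight_append]
  obtain ⟨P, hP⟩ := q₁.reachable.exists_walk_length_eq_dist
  apply le_antisymm
  · by_cases h₁ : q₁.length ≤ G.dist a b
    · exact (dist_coe_le_length q₁ hsub₁ ha hb).trans h₁
    by_cases h₂ : q₂.length ≤ G.dist a b
    · rw [← Walk.length_reverse] at h₂
      exact (dist_coe_le_length q₂.reverse
        (by rwa [Walk.toSubgraph_reverse]) ha hb).trans h₂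
    have e₁ := hmin _ (q₁.append P.reverse) (by simp; omega)
    have e₂ := hmin _ (P.append q₂) (by simp; omega)
    simp only [edgeWeight_append, edgeWeight_reverse] at e₁ e₂
    exfalso
    have : edgeWeight g q₁ + edgeWeight g q₂ + (edgeWeight g P + edgeWeight g P) = 0 := by
      linear_combination e₁ + e₂
    simp [CharTwo.add_self_eq_zero, hodd'] at this
  · obtain ⟨Q, hQ⟩ := (w.toSubgraph_connected.coe ⟨a, ha⟩ ⟨b, hb⟩).exists_walk_length_eq_dist
    rw [← hQ, ← Walk.length_map w.toSubgraph.hom]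
    exact SimpleGraph.dist_le _

/-- If some closed walk has odd weight, then so does some geodesic cycle. -/
theorem exists_odd_geodesic_cycle (g : Sym2 V → ZMod 2) {v : V} (w : G.Walk v v)
    (hw : edgeWeight g w = 1) :
    ∃ (x : V) (c : G.Walk x x), edgeWeight g c = 1 ∧ IsCycleSubgraph c.toSubgraph ∧
      IsGeodesicSubgraph c.toSubgraph := by
  classical
  have hex : ∃ n, ∃ (x : V) (c : G.Walk x x), c.length = n ∧ edgeWeight g c = 1 :=
    ⟨_, v, w, rfl, hw⟩
  obtain ⟨x, c, hc, hodd⟩ := Nat.find_spec hex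
  have hmin : ∀ (y : V) (d : G.Walk y y), d.length < c.length → edgeWeight g d = 0 := by
    intro y d hd
    rw [hc] at hd
    by_contra hne
    exact Nat.find_min hex hd
      ⟨y, d, rfl, by_contra fun h => hne (ZMod.eq_zero_of_ne_one h)⟩
  have hcyc := isCycle_of_shortest_odd g c hodd hmin
  exact ⟨x, c, hodd,
    ⟨c.toSubgraph_connected, fun u hu =>
      hcyc.ncard_neighborSet_toSubgraph_eq_two (c.mem_verts_toSubgraph.1 hu)⟩,
    isGeodesic_of_shortest_odd g c hodd hmin⟩

theorem edgeWeight_eq_zero_of_forall (g : Sym2 V → ZMod 2) {u v : V} (w : G.Walk u v)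
    (h : ∀ e ∈ w.edges, g e = 0) : edgeWeight g w = 0 := by
  refine List.sum_eq_zero fun x hx => ?_
  obtain ⟨e, he, rfl⟩ := List.mem_map.1 hx
  exact h e he

/-- Along a walk on which `g` is the coboundary of `p`, the weight telescopes. -/
theorem edgeWeight_eq_add_of_coboundary (g : Sym2 V → ZMod 2) (p : V → ZMod 2) {u v : V}
    (w : G.Walk u v) (h : ∀ x y, s(x, y) ∈ w.edges → g s(x, y) = p x + p y) :
    edgeWeight g w = p u + p v := by
  induction w with
  | nil => simp [CharTwo.add_self_eq_zero]
  | @cons u x v hux w ih =>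
    rw [edgeWeight_cons, h u x (by simp), ih fun y z hyz => h y z (by simp [hyz])]
    linear_combination CharTwo.add_self_eq_zero (p x)

/-- A weighting that is even on closed walks is a coboundary. -/
theorem exists_potential (hG : G.Connected) (g : Sym2 V → ZMod 2)
    (h : ∀ (x : V) (c : G.Walk x x), edgeWeight g c = 0) (b : V) :
    ∃ p : V → ZMod 2, p b = 0 ∧ ∀ u v, G.Adj u v → p v = p u + g s(u, v) := by
  refine ⟨fun v => edgeWeight g (hG.preconnected b v).some, h _ _, fun u v huv => ?_⟩
  have := h b (((hG.preconnected b u).some.append (Walk.cons huv Walk.nil)).append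
    (hG.preconnected b v).some.reverse)
  simp only [edgeWeight_append, edgeWeight_reverse, edgeWeight_cons, edgeWeight_nil,
    add_zero] at this
  linear_combination CharTwo.add_self_eq_zero
    (edgeWeight g (hG.preconnected b v).some) - this

/-- Every vertex of a two-connected graph lies on a geodesic cycle. -/
theorem TwoConnected.exists_geodesic_cycle_mem [Fintype V] (hG : TwoConnected G) (v : V) :
    ∃ H : G.Subgraph, IsCycleSubgraph H ∧ IsGeodesicSubgraph H ∧ v ∈ H.verts := by
  classical
  obtain ⟨hconn, hcard, hcut⟩ := hG
  have : Nontrivial V := Fintype.one_lt_card_iff_nontrivial.1 (by omega)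
  obtain ⟨x, hvx⟩ := hconn.preconnected.exists_adj_of_nontrivial v
  obtain ⟨z, hzv, hzx⟩ : ∃ z, z ≠ v ∧ z ≠ x := by
    by_contra! hall
    have : Fintype.card V ≤ 2 := by
      rw [← Finset.card_univ]
      refine (Finset.card_le_card (t := {v, x}) fun z _ => ?_).trans Finset.card_le_two
      have := hall z
      simp only [Finset.mem_insert, Finset.mem_singleton]
      tauto
    omega
  obtain ⟨y, hvy, hyx⟩ : ∃ y, G.Adj v y ∧ y ≠ x := by
    have : Nontrivial {y | y ≠ x} :=
      ⟨⟨v, hvx.ne⟩, ⟨z, hzx⟩, fun h => hzv (congrArg Subtype.val h).symm⟩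
    obtain ⟨y, hy⟩ := (hcut x).preconnected.exists_adj_of_nontrivial ⟨v, hvx.ne⟩
    exact ⟨y, hy, y.2⟩
  obtain ⟨q⟩ := (hcut v).preconnected ⟨x, hvx.ne'⟩ ⟨y, hvy.ne'⟩
  obtain ⟨q', hq'⟩ : ∃ q' : G.Walk x y, v ∉ q'.support := by
    refine ⟨q.map (Embedding.induce {y | y ≠ v}).toHom, fun hv => ?_⟩
    erw [Walk.support_map] at hv
    obtain ⟨u, -, hu⟩ := List.mem_map.1 hv
    exact u.2 hu
  let g : Sym2 V → ZMod 2 := fun e => if e = s(v, x) then 1 else 0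
  let w : G.Walk v v := Walk.cons hvx (q'.append (Walk.cons hvy.symm Walk.nil))
  have hw : edgeWeight g w = 1 := by
    have hq0 : edgeWeight g q' = 0 := by
      refine edgeWeight_eq_zero_of_forall g q' fun e he => if_neg ?_
      rintro rfl
      exact hq' (q'.fst_mem_support_of_mem_edges he)
    have hyv : s(y, v) ≠ s(v, x) := by
      have := hvx.ne
      have := hvy.ne
      grind
    have h₁ : g s(v, x) = 1 := if_pos rfl
    have h₂ : g s(y, v) = 0 := if_neg hyv
    change edgeWeight g (Walk.cons hvx (q'.append (Walk.cons hvy.symm Walk.nil))) = 1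
    simp only [edgeWeight_cons, edgeWeight_append, edgeWeight_nil, h₁, h₂, hq0, add_zero]
  obtain ⟨a, c, hc, hcyc, hgeo⟩ := exists_odd_geodesic_cycle g w hw
  refine ⟨c.toSubgraph, hcyc, hgeo, ?_⟩
  by_contra hv
  rw [Walk.mem_verts_toSubgraph] at hv
  rw [edgeWeight_eq_zero_of_forall g c fun e he => if_neg ?_] at hc
  · exact zero_ne_one hc
  · rintro rfl
    exact hv (c.fst_mem_support_of_mem_edges he)

end OddClosedWalks

namespace TreeDecomp

variable {V ι κ : Type} {G : SimpleGraph V}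

/-- An atomic decomposition cannot be improved by lowering the number of bags of some size without
raising the number of larger bags. -/
theorem IsAtomic.false_of_count_lt [Fintype V] [Fintype κ] {D : TreeDecomp G ι} (hD : D.IsAtomic)
    (D' : TreeDecomp G κ) (s : ℕ) (hs : s ≤ Fintype.card V)
    (hlt : {j | (D'.bag j).ncard = s}.ncard < {i | (D.bag i).ncard = s}.ncard)
    (hle : ∀ r > s, {j | (D'.bag j).ncard = r}.ncard ≤ {i | (D.bag i).ncard = r}.ncard) :
    False := by
  have hlt' : D'.fatness ⟨Fintype.card V - s, by omega⟩ <
      D.fatness ⟨Fintype.card V - s, by omega⟩ := by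
    simpa [fatness, Nat.sub_sub_self hs] using hlt
  rcases hD κ inferInstance D' with heq | ⟨k, hk, hklt⟩
  · rw [heq] at hlt'
    exact lt_irrefl _ hlt'
  · rcases lt_or_ge (⟨Fintype.card V - s, by omega⟩ : Fin (Fintype.card V + 1)) k with h | h
    · exact hlt'.ne' (hk _ h)
    · rcases h.eq_or_lt with h | h
      · rw [← h] at hlt'
        exact lt_asymm hlt' hklt
      · refine absurd hklt (not_lt.2 (hle _ ?_))
        have : (k : ℕ) < Fintype.card V - s := h
        omega

/-- Two copies of a tree joined by an edge. -/
def doubled (T : SimpleGraph ι) (t : ι) : SimpleGraph (ι ⊕ ι) :=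
  (T ⊕g T) ⊔ edge (.inl t) (.inr t)

theorem doubled_isTree [Finite ι] {T : SimpleGraph ι} (hT : T.IsTree) (t : ι) :
    (doubled T t).IsTree := by
  have hconn : (doubled T t).Connected := hT.connected.sum_sup_edge hT.connected
  refine isTree_iff_connected_and_card.2 ⟨hconn, le_antisymm ?_
    hconn.card_vert_le_card_edgeSet_add_one⟩
  have hc := (isTree_iff_connected_and_card.1 hT).2
  have hsum : Nat.card (T ⊕g T).edgeSet = Nat.card T.edgeSet + Nat.card T.edgeSet := by
    rw [Nat.card_congr edgeSetSumEquiv, Nat.card_sum]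
  have hsub : (doubled T t).edgeSet ⊆ (T ⊕g T).edgeSet ∪ {s(.inl t, .inr t)} := by
    rw [doubled, edgeSet_sup]
    exact Set.union_subset_union_right _ (by simp)
  have h₁ := (Set.ncard_le_ncard hsub (Set.toFinite _)).trans (Set.ncard_union_le _ _)
  rw [Set.ncard_singleton, ← Nat.card_coe_set_eq, ← Nat.card_coe_set_eq] at h₁
  rw [Nat.card_sum]
  omega

/-- Split a tree decomposition along a separation whose separator lies in the bag at `t`. -/
def split [Finite ι] (D : TreeDecomp G ι) (t : ι) (P Q : Set V) (hPQ : ∀ v, v ∈ P ∨ v ∈ Q)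
    (hsep : P ∩ Q ⊆ D.bag t) (hadj : ∀ u v, G.Adj u v → (u ∈ P ∧ v ∈ P) ∨ (u ∈ Q ∧ v ∈ Q)) :
    TreeDecomp G (ι ⊕ ι) where
  tree := doubled D.tree t
  isTree := doubled_isTree D.isTree t
  bag := Sum.elim (fun i => D.bag i ∩ P) (fun i => D.bag i ∩ Q)
  covers v := by
    obtain ⟨i, hi⟩ := D.covers v
    rcases hPQ v with h | h
    · exact ⟨.inl i, hi, h⟩
    · exact ⟨.inr i, hi, h⟩
  coversEdge v w hvw := by
    obtain ⟨i, hv, hw⟩ := D.coversEdge hvw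
    rcases hadj v w hvw with ⟨h, h'⟩ | ⟨h, h'⟩
    · exact ⟨.inl i, ⟨hv, h⟩, hw, h'⟩
    · exact ⟨.inr i, ⟨hv, h⟩, hw, h'⟩
  bagConn v := by
    set S : Set (ι ⊕ ι) :=
      {k | v ∈ Sum.elim (fun i => D.bag i ∩ P) (fun i => D.bag i ∩ Q) k}
    have hinl : ∀ (hv : v ∈ P) (i j : ι) (hi : v ∈ D.bag i) (hj : v ∈ D.bag j),
        ((doubled D.tree t).induce S).Reachable ⟨.inl i, hi, hv⟩ ⟨.inl j, hj, hv⟩ := by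
      intro hv i j hi hj
      let φ : D.tree.induce {i | v ∈ D.bag i} →g (doubled D.tree t).induce S :=
        ⟨fun k => ⟨.inl k.1, k.2, hv⟩, fun h => Or.inl h⟩
      exact ((D.bagConn v).preconnected ⟨i, hi⟩ ⟨j, hj⟩).map φ
    have hinr : ∀ (hv : v ∈ Q) (i j : ι) (hi : v ∈ D.bag i) (hj : v ∈ D.bag j),
        ((doubled D.tree t).induce S).Reachable ⟨.inr i, hi, hv⟩ ⟨.inr j, hj, hv⟩ := by
      intro hv i j hi hj
      let φ : D.tree.induce {i | v ∈ D.bag i} →g (doubled D.tree t).induce S :=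
        ⟨fun k => ⟨.inr k.1, k.2, hv⟩, fun h => Or.inl h⟩
      exact ((D.bagConn v).preconnected ⟨i, hi⟩ ⟨j, hj⟩).map φ
    have hcross : ∀ (hP : v ∈ P) (hQ : v ∈ Q) (i j : ι) (hi : v ∈ D.bag i) (hj : v ∈ D.bag j),
        ((doubled D.tree t).induce S).Reachable ⟨.inl i, hi, hP⟩ ⟨.inr j, hj, hQ⟩ := by
      intro hP hQ i j hi hj
      have ht : v ∈ D.bag t := hsep ⟨hP, hQ⟩
      refine (hinl hP i t hi ht).trans (.trans (Adj.reachable ?_) (hinr hQ t j ht hj))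
      simp [doubled, edge_adj]
    rw [connected_iff]
    constructor
    · rintro ⟨i | i, hi, hv⟩ ⟨j | j, hj, hv'⟩
      · exact hinl hv i j hi hj
      · exact hcross hv hv' i j hi hj
      · exact (hcross hv' hv j i hj hi).symm
      · exact hinr hv i j hi hj
    · obtain ⟨i, hi⟩ := D.covers v
      rcases hPQ v with h | h
      · exact ⟨.inl i, hi, h⟩
      · exact ⟨.inr i, hi, h⟩

/-- No separation with separator inside a bag of an atomic decomposition splits that bag. -/
theorem IsAtomic.subset_or_subset_of_separation [Fintype V] [Fintype ι] {D : TreeDecomp G ι}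
    (hD : D.IsAtomic) (t : ι) (P Q : Set V) (hPQ : ∀ v, v ∈ P ∨ v ∈ Q) (hsep : P ∩ Q ⊆ D.bag t)
    (hadj : ∀ u v, G.Adj u v → (u ∈ P ∧ v ∈ P) ∨ (u ∈ Q ∧ v ∈ Q)) :
    D.bag t ⊆ P ∨ D.bag t ⊆ Q := by
  classical
  by_contra! hcon
  obtain ⟨htP, htQ⟩ := hcon
  have hfin : ∀ A : Set V, A.Finite := fun A => A.toFinite
  obtain ⟨m, ⟨hmP, hmQ⟩, hmax⟩ := Set.exists_max_image
    {i | ¬ D.bag i ⊆ P ∧ ¬ D.bag i ⊆ Q} (fun i => (D.bag i).ncard) (Set.toFinite _) ⟨t, htP, htQ⟩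
  have htm := hmax t ⟨htP, htQ⟩
  have hsmall : (P ∩ Q).ncard < (D.bag m).ncard :=
    (Set.ncard_lt_ncard (hsep.ssubset_of_not_subset fun h => htP fun x hx => (h hx).1)
      (hfin _)).trans_le htm
  have keyP : ∀ i, (D.bag m).ncard ≤ (D.bag i ∩ P).ncard → D.bag i ⊆ P := by
    intro i hi
    by_contra hP
    have hlt : (D.bag i ∩ P).ncard < (D.bag i).ncard :=
      Set.ncard_lt_ncard (Set.inter_subset_left.ssubset_of_not_subset
        fun h => hP fun x hx => (h hx).2) (hfin _)
    by_cases hQ : D.bag i ⊆ Q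
    · have : (D.bag i ∩ P).ncard ≤ (P ∩ Q).ncard :=
        Set.ncard_le_ncard (fun x hx => ⟨hx.2, hQ hx.1⟩) (hfin _)
      omega
    · have := hmax i ⟨hP, hQ⟩
      omega
  have keyQ : ∀ i, (D.bag m).ncard ≤ (D.bag i ∩ Q).ncard → D.bag i ⊆ Q := by
    intro i hi
    by_contra hQ
    have hlt : (D.bag i ∩ Q).ncard < (D.bag i).ncard :=
      Set.ncard_lt_ncard (Set.inter_subset_left.ssubset_of_not_subset
        fun h => hQ fun x hx => (h hx).2) (hfin _)
    by_cases hP : D.bag i ⊆ P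
    · have : (D.bag i ∩ Q).ncard ≤ (P ∩ Q).ncard :=
        Set.ncard_le_ncard (fun x hx => ⟨hP hx.1, hx.2⟩) (hfin _)
      omega
    · have := hmax i ⟨hP, hQ⟩
      omega
  have hcount : ∀ r ≥ (D.bag m).ncard,
      {j | ((D.split t P Q hPQ hsep hadj).bag j).ncard = r}.ncard ≤
        {i | (D.bag i).ncard = r ∧ (D.bag i ⊆ P ∨ D.bag i ⊆ Q)}.ncard := by
    intro r hr
    refine Set.ncard_le_ncard_of_injOn (Sum.elim id id) ?_ ?_ (Set.toFinite _)
    · rintro (i | i) hi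
      · have hi : (D.bag i ∩ P).ncard = r := hi
        have hP := keyP i (by omega)
        rw [Set.inter_eq_left.2 hP] at hi
        exact ⟨hi, .inl hP⟩
      · have hi : (D.bag i ∩ Q).ncard = r := hi
        have hQ := keyQ i (by omega)
        rw [Set.inter_eq_left.2 hQ] at hi
        exact ⟨hi, .inr hQ⟩
    · have hne : ∀ i, (D.bag i ∩ P).ncard = r → (D.bag i ∩ Q).ncard = r → False := by
        intro i hi hj
        have hP := keyP i (by omega)
        have hQ := keyQ i (by omega)
        have : (D.bag i ∩ P).ncard ≤ (P ∩ Q).ncard :=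
          Set.ncard_le_ncard (fun x hx => ⟨hx.2, hQ hx.1⟩) (hfin _)
        omega
      rintro (i | i) hi (j | j) hj hij
      · exact congrArg Sum.inl hij
      · obtain rfl : i = j := hij
        exact (hne i hi hj).elim
      · obtain rfl : i = j := hij
        exact (hne i hj hi).elim
      · exact congrArg Sum.inr hij
  refine hD.false_of_count_lt (D.split t P Q hPQ hsep hadj) (D.bag m).ncard ?_ ?_ ?_
  · rw [← Nat.card_eq_fintype_card]
    exact Set.ncard_le_card _
  · refine (hcount _ le_rfl).trans_lt (Set.ncard_lt_ncard ?_ (Set.toFinite _))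
    refine Set.ssubset_iff_of_subset (fun i hi => hi.1) |>.2 ⟨m, rfl, fun h => ?_⟩
    exact h.2.elim hmP hmQ
  · exact fun r hr => (hcount r hr.le).trans (Set.ncard_le_ncard (fun i hi => hi.1) (Set.toFinite _))

/-- Move the node `t` to `t'`, leaving all other nodes fixed. -/
noncomputable def retract {t t' : ι} (h : t' ≠ t) (i : ι) : {i // i ≠ t} :=
  open Classical in if hi : i = t then ⟨t', h⟩ else ⟨i, hi⟩

theorem retract_self {t t' : ι} (h : t' ≠ t) : retract h t = ⟨t', h⟩ := by simp [retract]

theorem retract_of_ne {t t' i : ι} (h : t' ≠ t) (hi : i ≠ t) : retract h i = ⟨i, hi⟩ := by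
  simp [retract, hi]

/-- Contract the node `t` of a graph into `t'`. -/
def contracted (T : SimpleGraph ι) {t t' : ι} (h : t' ≠ t) : SimpleGraph {i // i ≠ t} where
  Adj a b := a ≠ b ∧ ∃ u v, T.Adj u v ∧ retract h u = a ∧ retract h v = b
  symm := ⟨fun _ _ ⟨hne, u, v, huv, hu, hv⟩ => ⟨hne.symm, v, u, huv.symm, hv, hu⟩⟩
  loopless := ⟨fun _ h => h.1 rfl⟩

theorem contracted_reachable {T : SimpleGraph ι} {t t' : ι} (h : t' ≠ t) (Y : Set ι)
    (Z : Set {i // i ≠ t}) (hZ : ∀ i ∈ Y, retract h i ∈ Z) {u v : Y}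
    (w : (T.induce Y).Walk u v) :
    ((contracted T h).induce Z).Reachable ⟨retract h u, hZ _ u.2⟩ ⟨retract h v, hZ _ v.2⟩ := by
  induction w with
  | nil => exact .refl _
  | @cons u x v hux w ih =>
    refine .trans ?_ ih
    by_cases heq : retract h (u : ι) = retract h (x : ι)
    · simp only [heq]
      exact .refl _
    · exact Adj.reachable (G := (contracted T h).induce Z) ⟨heq, u, x, hux, rfl, rfl⟩

theorem contracted_isTree [Finite ι] {T : SimpleGraph ι} (hT : T.IsTree) {t t' : ι}
    (htt' : T.Adj t t') : (contracted T htt'.ne').IsTree := by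
  have hconn : (contracted T htt'.ne').Connected := by
    have hne : Nonempty {i // i ≠ t} := ⟨t', htt'.ne'⟩
    refine ⟨fun a b => ?_⟩
    obtain ⟨w⟩ := (hT.connected.preconnected a b).map (induceUnivIso T).symm.toHom
    have := (contracted_reachable htt'.ne' Set.univ Set.univ (by simp) w).map
      (induceUnivIso _).toHom
    have ha : retract htt'.ne' (a : ι) = a := retract_of_ne _ a.2
    have hb : retract htt'.ne' (b : ι) = b := retract_of_ne _ b.2
    rw [← ha, ← hb]
    exact this
  refine isTree_iff_connected_and_card.2 ⟨hconn, le_antisymm ?_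
    hconn.card_vert_le_card_edgeSet_add_one⟩
  have hc := (isTree_iff_connected_and_card.1 hT).2
  have hsub : (contracted T htt'.ne').edgeSet ⊆
      Sym2.map (retract htt'.ne') '' (T.edgeSet \ {s(t, t')}) := by
    intro e
    induction e with | _ a b
    rintro ⟨hne, u, v, huv, rfl, rfl⟩
    refine ⟨s(u, v), ⟨huv, fun heq => hne ?_⟩, rfl⟩
    have h₁ := retract_self htt'.ne'
    have h₂ := retract_of_ne htt'.ne' htt'.ne'
    rcases Sym2.eq_iff.1 (Set.mem_singleton_iff.1 heq) with ⟨rfl, rfl⟩ | ⟨rfl, rfl⟩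
    · rw [h₁, h₂]
    · rw [h₁, h₂]
  have h₁ := (Set.ncard_le_ncard hsub (Set.toFinite _)).trans (Set.ncard_image_le (Set.toFinite _))
  have h₂ := Set.ncard_sdiff_singleton_add_one (a := s(t, t')) (s := T.edgeSet) htt'
    (Set.toFinite _)
  have h₃ : Nat.card {i // i ≠ t} + 1 = Nat.card ι := by
    have := Fintype.ofFinite ι
    classical
    have hpos : 0 < Fintype.card ι := Fintype.card_pos_iff.2 ⟨t⟩
    rw [Nat.card_eq_fintype_card, Nat.card_eq_fintype_card, Fintype.card_subtype_compl,
      Fintype.card_subtype_eq]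
    omega
  rw [Nat.card_coe_set_eq] at hc ⊢
  omega

/-- Remove a node whose bag is contained in the bag of a neighbour. -/
def contract [Finite ι] (D : TreeDecomp G ι) {t t' : ι} (htt' : D.tree.Adj t t')
    (hsub : D.bag t ⊆ D.bag t') : TreeDecomp G {i // i ≠ t} :=
  have hret : ∀ i, D.bag i ⊆ D.bag (retract htt'.ne' i).1 := by
    intro i
    by_cases hi : i = t
    · subst hi
      rwa [retract_self]
    · rw [retract_of_ne _ hi]
  { tree := contracted D.tree htt'.ne'
    isTree := contracted_isTree D.isTree htt'
    bag := fun i => D.bag i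
    covers := fun v => by
      obtain ⟨i, hi⟩ := D.covers v
      exact ⟨_, hret i hi⟩
    coversEdge := fun v w hvw => by
      obtain ⟨i, hv, hw⟩ := D.coversEdge hvw
      exact ⟨_, hret i hv, hret i hw⟩
    bagConn := fun v => by
      rw [connected_iff]
      refine ⟨fun a b => ?_, ?_⟩
      · obtain ⟨w⟩ := (D.bagConn v).preconnected ⟨a.1, a.2⟩ ⟨b.1, b.2⟩
        have := contracted_reachable htt'.ne' {i | v ∈ D.bag i} {i | v ∈ D.bag i.1}
          (fun i hi => hret i hi) w
        simpa only [retract_of_ne htt'.ne' a.1.2, retract_of_ne htt'.ne' b.1.2] using this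
      · obtain ⟨i, hi⟩ := D.covers v
        exact ⟨_, hret i hi⟩ }

/-- In an atomic decomposition no bag is contained in a neighbouring bag. -/
theorem IsAtomic.not_subset_of_adj [Fintype V] [Fintype ι] {D : TreeDecomp G ι} (hD : D.IsAtomic)
    {t t' : ι} (htt' : D.tree.Adj t t') : ¬ D.bag t ⊆ D.bag t' := by
  classical
  intro hsub
  have himage : ∀ r, {j : {i // i ≠ t} | (D.bag j).ncard = r}.ncard =
      ({i | (D.bag i).ncard = r} \ {t}).ncard := by
    intro r
    rw [← Set.ncard_image_of_injective _ Subtype.val_injective]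
    congr 1
    ext i
    simp
  refine hD.false_of_count_lt (D.contract htt' hsub) (D.bag t).ncard ?_ ?_ ?_
  · rw [← Nat.card_eq_fintype_card]
    exact Set.ncard_le_card _
  · exact (himage _).trans_lt (Set.ncard_sdiff_singleton_lt_of_mem rfl (Set.toFinite _))
  · exact fun r _ => (himage r).trans_le (Set.ncard_sdiff_singleton_le _ _)

end TreeDecomp

section Components

variable {V ι : Type} {G : SimpleGraph V}

/-- The vertices reachable from `c` by walks that avoid `X` after `c`. -/
def componentAvoiding (G : SimpleGraph V) (X : Set V) (c : V) : Set V :=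
  {v | Relation.ReflTransGen (fun u v => G.Adj u v ∧ v ∉ X) c v}

theorem mem_componentAvoiding_self (X : Set V) (c : V) : c ∈ componentAvoiding G X c := .refl

theorem componentAvoiding_step {X : Set V} {c u v : V} (hu : u ∈ componentAvoiding G X c)
    (huv : G.Adj u v) (hv : v ∉ X) : v ∈ componentAvoiding G X c :=
  .tail hu ⟨huv, hv⟩

theorem componentAvoiding_induction {X : Set V} {c : V} (hc : c ∉ X) {p : V → Prop} (h : p c)
    (hstep : ∀ u v, u ∈ componentAvoiding G X c → u ∉ X → G.Adj u v → v ∉ X → p u → p v)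
    {v : V} (hv : v ∈ componentAvoiding G X c) : v ∉ X ∧ p v := by
  induction hv with
  | refl => exact ⟨hc, h⟩
  | tail hu huv ih => exact ⟨huv.2, hstep _ _ hu ih.1 huv.1 huv.2 ih.2⟩

theorem notMem_of_mem_componentAvoiding {X : Set V} {c v : V} (hc : c ∉ X)
    (hv : v ∈ componentAvoiding G X c) : v ∉ X :=
  (componentAvoiding_induction (p := fun _ => True) hc trivial (fun _ _ _ _ _ _ _ => trivial) hv).1

theorem exists_adj_boundary {T : SimpleGraph ι} {Y : Set ι} (hY : (T.induce Y).Connected)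
    (S : Set ι) {a b : ι} (haY : a ∈ Y) (haS : a ∈ S) (hbY : b ∈ Y) (hbS : b ∉ S) :
    ∃ u v, u ∈ Y ∧ u ∈ S ∧ v ∈ Y ∧ v ∉ S ∧ T.Adj u v := by
  obtain ⟨w⟩ := hY.preconnected ⟨a, haY⟩ ⟨b, hbY⟩
  obtain ⟨d, -, h₁, h₂⟩ := w.exists_boundary_dart {y | (y : ι) ∈ S} haS hbS
  exact ⟨d.fst, d.snd, d.fst.2, h₁, d.snd.2, h₂, d.adj⟩

/-- A component of the complement of a bag of an atomic decomposition has a non-neighbour in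
that bag. -/
theorem TreeDecomp.IsAtomic.exists_not_adj_component [Fintype V] [Fintype ι] {D : TreeDecomp G ι}
    (hD : D.IsAtomic) {t : ι} {c : V} (hc : c ∉ D.bag t) :
    ∃ x ∈ D.bag t, ∀ v ∈ componentAvoiding G (D.bag t) c, ¬ G.Adj v x := by
  classical
  by_contra! hcon
  obtain ⟨i₀, hi₀⟩ := D.covers c
  obtain ⟨w, hw⟩ := (D.isTree.connected.preconnected t i₀).exists_isPath
  cases w with
  | nil => exact hc hi₀
  | @cons _ t' _ htt' p =>
    rw [Walk.cons_isPath_iff] at hw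
    let S : Set ι := {j | (D.tree.deleteEdges {s(t, t')}).Reachable t' j}
    have hi₀S : i₀ ∈ S := by
      refine ⟨p.toDeleteEdges {s(t, t')} fun e he heq => ?_⟩
      rw [Set.mem_singleton_iff.1 heq] at he
      exact hw.2 (p.fst_mem_support_of_mem_edges he)
    have htS : t ∉ S := fun h =>
      isBridge_iff.1 (isAcyclic_iff_forall_adj_isBridge.1 D.isTree.isAcyclic htt') h.symm
    have hcross : ∀ a b, a ∈ S → b ∉ S → D.tree.Adj a b → a = t' ∧ b = t := by
      intro a b ha hb hab
      by_cases he : s(a, b) = s(t, t')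
      · rcases Sym2.eq_iff.1 he with ⟨rfl, rfl⟩ | ⟨rfl, rfl⟩
        · exact (htS ha).elim
        · exact ⟨rfl, rfl⟩
      · refine (hb (ha.trans (Adj.reachable ?_))).elim
        rw [deleteEdges_adj]
        exact ⟨hab, he⟩
    have hside : ∀ v, v ∉ D.bag t → ∀ i ∈ S, v ∈ D.bag i → ∀ j, v ∈ D.bag j → j ∈ S := by
      intro v hv i hi hvi j hvj
      by_contra hj
      obtain ⟨a, b, -, haS, hbY, hbS, hab⟩ := exists_adj_boundary (D.bagConn v) S hvi hi hvj hj
      obtain ⟨-, rfl⟩ := hcross a b haS hbS hab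
      exact hv hbY
    refine hD.not_subset_of_adj htt' fun x hx => ?_
    obtain ⟨v, hvC, hvx⟩ := hcon x hx
    obtain ⟨-, hvS⟩ := componentAvoiding_induction (p := fun v => ∀ j, v ∈ D.bag j → j ∈ S) hc
      (hside c hc i₀ hi₀S hi₀) (fun u v _ _ huv hv hu => by
        obtain ⟨i, hui, hvi⟩ := D.coversEdge huv
        exact hside v hv i (hu i hui) hvi) hvC
    obtain ⟨i, hvi, hxi⟩ := D.coversEdge hvx
    obtain ⟨a, b, haY, haS, -, hbS, hab⟩ :=
      exists_adj_boundary (D.bagConn x) S hxi (hvS i hvi) hx htS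
    obtain ⟨rfl, -⟩ := hcross a b haS hbS hab
    exact haY

theorem TreeDecomp.IsAtomic.bag_nonempty [Fintype V] [Nonempty V] [Fintype ι]
    {D : TreeDecomp G ι} (hD : D.IsAtomic) (t : ι) : (D.bag t).Nonempty := by
  obtain ⟨c⟩ := ‹Nonempty V›
  by_cases hc : c ∈ D.bag t
  · exact ⟨c, hc⟩
  · obtain ⟨x, hx, -⟩ := hD.exists_not_adj_component hc
    exact ⟨x, hx⟩

/-- Some component of the complement of `A ∪ B` has neighbours in both `A` and `B`. -/
theorem exists_straddling_component (hG : G.Connected) {A B : Set V} (hA : A.Nonempty)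
    (hB : B.Nonempty) (hAB : Disjoint A B) (hnadj : ∀ a ∈ A, ∀ b ∈ B, ¬ G.Adj a b) :
    ∃ c, c ∉ A ∪ B ∧ (∃ a ∈ A, ∃ u ∈ componentAvoiding G (A ∪ B) c, G.Adj u a) ∧
      ∃ b ∈ B, ∃ u ∈ componentAvoiding G (A ∪ B) c, G.Adj u b := by
  obtain ⟨a, ha⟩ := hA
  obtain ⟨b, hb⟩ := hB
  let M : Set V := {v | v ∈ A ∨ ∃ c, c ∉ A ∪ B ∧ (∃ a ∈ A, G.Adj c a) ∧
    v ∈ componentAvoiding G (A ∪ B) c}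
  have hbM : b ∉ M := by
    rintro (h | ⟨c, hc, -, h⟩)
    · exact hAB.notMem_of_mem_left h hb
    · exact notMem_of_mem_componentAvoiding hc h (.inr hb)
  obtain ⟨w⟩ := hG.preconnected a b
  obtain ⟨d, -, hu, hv⟩ := w.exists_boundary_dart M (.inl ha) hbM
  have huv := d.adj
  rcases hu with hu | ⟨c, hc, ⟨a', ha', hca'⟩, hu⟩
  · refine (hv (.inr ⟨d.snd, ?_, ⟨d.fst, hu, huv.symm⟩, mem_componentAvoiding_self _ _⟩)).elim
    rintro (h | h)
    · exact hv (.inl h)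
    · exact hnadj _ hu _ h huv
  · by_cases hvX : d.snd ∈ A ∪ B
    · rcases hvX with h | h
      · exact (hv (.inl h)).elim
      · exact ⟨c, hc, ⟨a', ha', c, mem_componentAvoiding_self _ _, hca'⟩, _, h, _, hu, huv⟩
    · exact (hv (.inr ⟨c, hc, ⟨a', ha', hca'⟩, componentAvoiding_step hu huv hvX⟩)).elim

/-- If no geodesic cycle meets both halves of a bag partition of an atomic decomposition, then
there is an edge between the halves. -/
theorem TreeDecomp.IsAtomic.exists_adj_of_partition [Fintype V] [Fintype ι] (hG : G.Connected)
    {D : TreeDecomp G ι} (hD : D.IsAtomic) (t : ι) {A B : Set V} (hA : A.Nonempty)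
    (hB : B.Nonempty) (hAB : Disjoint A B) (hX : A ∪ B = D.bag t)
    (hcyc : ∀ H : G.Subgraph, IsCycleSubgraph H → IsGeodesicSubgraph H →
      ∀ a ∈ A, ∀ b ∈ B, a ∈ H.verts → b ∉ H.verts) :
    ∃ a ∈ A, ∃ b ∈ B, G.Adj a b := by
  classical
  by_contra! hnadj
  obtain ⟨c, hc, ⟨a, ha, a', ha'C, haa'⟩, b, hb, b', hb'C, hbb'⟩ :=
    exists_straddling_component hG hA hB hAB hnadj
  rw [hX] at hc ha'C hb'C
  obtain ⟨x, hx, hxC⟩ := hD.exists_not_adj_component hc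
  set C := componentAvoiding G (D.bag t) c
  have hCX : ∀ v ∈ C, v ∉ D.bag t := fun v hv => notMem_of_mem_componentAvoiding hc hv
  have hAX : ∀ v ∈ A, v ∈ D.bag t := fun v hv => hX ▸ Or.inl hv
  have hBX : ∀ v ∈ B, v ∈ D.bag t := fun v hv => hX ▸ Or.inr hv
  have hABn : ∀ v ∈ A, v ∉ B := fun v hv => hAB.notMem_of_mem_left hv
  let g : Sym2 V → ZMod 2 := fun e => if ∃ u ∈ C, ∃ v ∈ A, e = s(u, v) then 1 else 0
  have hg : ∀ u v, g s(u, v) = if (u ∈ C ∧ v ∈ A) ∨ (v ∈ C ∧ u ∈ A) then 1 else 0 := by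
    intro u v
    refine if_congr ⟨?_, ?_⟩ rfl rfl
    · rintro ⟨u', hu', v', hv', h⟩
      rcases Sym2.eq_iff.1 h with ⟨rfl, rfl⟩ | ⟨rfl, rfl⟩
      · exact .inl ⟨hu', hv'⟩
      · exact .inr ⟨hu', hv'⟩
    · rintro (⟨h, h'⟩ | ⟨h, h'⟩)
      · exact ⟨u, h, v, h', rfl⟩
      · exact ⟨v, h, u, h', Sym2.eq_swap⟩
  have heven : ∀ (y : V) (w : G.Walk y y), edgeWeight g w = 0 := by
    intro y w
    refine ZMod.eq_zero_of_ne_one fun hodd => ?_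
    obtain ⟨z, w, hw, hwc, hwg⟩ := exists_odd_geodesic_cycle g w hodd
    have hmeet := hcyc _ hwc hwg
    simp only [Walk.mem_verts_toSubgraph] at hmeet
    by_cases hwA : ∃ a ∈ A, a ∈ w.support
    · obtain ⟨a, ha, haw⟩ := hwA
      let p : V → ZMod 2 := fun v => if v ∈ C then 1 else 0
      rw [edgeWeight_eq_add_of_coboundary g p w, CharTwo.add_self_eq_zero] at hw
      · exact zero_ne_one hw
      · intro u v huv
        have hadj := w.adj_of_mem_edges huv
        have huB : u ∉ B := fun h => hmeet a ha u h haw (w.fst_mem_support_of_mem_edges huv)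
        have hvB : v ∉ B := fun h => hmeet a ha v h haw (w.snd_mem_support_of_mem_edges huv)
        have h₁ : u ∈ C → v ∉ A → v ∈ C := fun h h' => componentAvoiding_step h hadj
          (hX ▸ fun h => h.elim h' hvB)
        have h₂ : v ∈ C → u ∉ A → u ∈ C := fun h h' => componentAvoiding_step h hadj.symm
          (hX ▸ fun h => h.elim h' huB)
        have h₃ : u ∈ A → u ∉ C := fun h h' => hCX u h' (hAX u h)
        have h₄ : v ∈ A → v ∉ C := fun h h' => hCX v h' (hAX v h)
        have h₅ : (1 : ZMod 2) + 1 = 0 := by decide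
        rw [hg]
        change _ = (if u ∈ C then (1 : ZMod 2) else 0) + if v ∈ C then 1 else 0
        by_cases huC : u ∈ C <;> by_cases hvC : v ∈ C <;> by_cases huA : u ∈ A <;>
          by_cases hvA : v ∈ A <;> simp_all
    · rw [edgeWeight_eq_zero_of_forall g w] at hw
      · exact zero_ne_one hw
      · intro e he
        refine if_neg ?_
        rintro ⟨u, -, v, hv, rfl⟩
        exact hwA ⟨v, hv, w.snd_mem_support_of_mem_edges he⟩
  obtain ⟨p, hpc, hp⟩ := exists_potential hG g heven c
  have hpC : ∀ v ∈ C, p v = 0 := by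
    intro v hv
    refine (componentAvoiding_induction (p := fun v => p v = 0) hc hpc ?_ hv).2
    intro u v _ hu huv hv hpu
    rw [hp u v huv, hpu, hg, if_neg, zero_add]
    rintro (⟨-, h⟩ | ⟨-, h⟩)
    · exact hv (hAX v h)
    · exact hu (hAX u h)
  have hpA : ∀ u ∈ C, ∀ v ∈ A, G.Adj u v → p v = 1 := by
    intro u hu v hv huv
    rw [hp u v huv, hpC u hu, hg, if_pos (.inl ⟨hu, hv⟩), zero_add]
  have hpB : ∀ u ∈ C, ∀ v ∈ B, G.Adj u v → p v = 0 := by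
    intro u hu v hv huv
    rw [hp u v huv, hpC u hu, hg, if_neg, zero_add]
    rintro (⟨-, h⟩ | ⟨h, -⟩)
    · exact hABn v h hv
    · exact hCX v h (hBX v hv)
  have hp01 : ∀ v, p v = 0 ∨ p v = 1 := fun v =>
    or_iff_not_imp_right.2 ZMod.eq_zero_of_ne_one
  have hjump : ∀ u v, G.Adj u v → p u = 0 → p v = 1 → u ∈ C ∧ v ∈ A := by
    intro u v huv hu hv
    have h := hp u v huv
    rw [hu, hv, hg] at h
    split_ifs at h with h'
    · rcases h' with h' | h'
      · exact h'
      · exact absurd ((hpC v h'.1).symm.trans hv) zero_ne_one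
    · simp at h
  have hpa := hpA a' ha'C a ha haa'
  have hpb := hpB b' hb'C b hb hbb'
  rcases hp01 x with hpx | hpx
  · have hsplit : D.bag t ⊆ {v | p v = 1 ∨ v ∈ C ∨ v ∈ B ∧ ∃ u ∈ C, G.Adj u v} ∨
        D.bag t ⊆ {v | p v = 0 ∧ v ∉ C} := by
      refine hD.subset_or_subset_of_separation t _ _ ?_ ?_ ?_
      · intro v
        rcases hp01 v with h | h
        · by_cases hv : v ∈ C
          · exact .inl (.inr (.inl hv))
          · exact .inr ⟨h, hv⟩
        · exact .inl (.inl h)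
      · rintro v ⟨h | h | h, hv⟩
        · exact absurd (hv.1.symm.trans h) zero_ne_one
        · exact absurd h hv.2
        · exact hBX v h.1
      · have key : ∀ u v, G.Adj u v → (p u = 0 ∧ u ∉ C) → ¬ (p v = 0 ∧ v ∉ C) →
            (p v = 1 ∨ v ∈ C ∨ v ∈ B ∧ ∃ u ∈ C, G.Adj u v) ∧
              (p u = 1 ∨ u ∈ C ∨ u ∈ B ∧ ∃ w ∈ C, G.Adj w u) := by
          rintro u v huv ⟨hu, huC⟩ hv
          rcases hp01 v with hv0 | hv1
          · have hvC : v ∈ C := by tauto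
            refine ⟨.inr (.inl hvC), .inr (.inr ⟨?_, v, hvC, huv.symm⟩)⟩
            have huX : u ∈ A ∪ B := by
              rw [hX]
              exact by_contra fun h => huC (componentAvoiding_step hvC huv.symm h)
            refine huX.resolve_left fun h => ?_
            exact zero_ne_one (hu.symm.trans (hpA v hvC u h huv.symm))
          · exact absurd (hjump u v huv hu hv1).1 huC
        have hcov : ∀ v, ¬ (p v = 0 ∧ v ∉ C) → p v = 1 ∨ v ∈ C := fun v h => by
          have := hp01 v
          tauto
        intro u v huv
        by_cases hu : p u = 0 ∧ u ∉ C <;> by_cases hv : p v = 0 ∧ v ∉ C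
        · exact .inr ⟨hu, hv⟩
        · exact .inl (key u v huv hu hv).symm
        · exact .inl (key v u huv.symm hv hu)
        · exact .inl ⟨(hcov u hu).imp_right .inl, (hcov v hv).imp_right .inl⟩
    rcases hsplit with h | h
    · rcases h hx with h | h | ⟨-, u, hu, hux⟩
      · exact zero_ne_one (hpx.symm.trans h)
      · exact hCX x h hx
      · exact hxC u hu hux
    · exact zero_ne_one ((h (hAX a ha)).1.symm.trans hpa)
  · have hsplit : D.bag t ⊆ {v | p v = 0 ∨ v ∈ A ∧ ∃ u ∈ C, G.Adj u v} ∨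
        D.bag t ⊆ {v | p v = 1} := by
      refine hD.subset_or_subset_of_separation t _ _ ?_ ?_ ?_
      · exact fun v => (hp01 v).imp_left .inl
      · rintro v ⟨h | h, hv⟩
        · exact absurd (h.symm.trans hv) zero_ne_one
        · exact hAX v h.1
      · intro u v huv
        rcases hp01 u with hu | hu <;> rcases hp01 v with hv | hv
        · exact .inl ⟨.inl hu, .inl hv⟩
        · obtain ⟨huC, hvA⟩ := hjump u v huv hu hv
          exact .inl ⟨.inl hu, .inr ⟨hvA, u, huC, huv⟩⟩
        · obtain ⟨hvC, huA⟩ := hjump v u huv.symm hv hu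
          exact .inl ⟨.inr ⟨huA, v, hvC, huv.symm⟩, .inl hv⟩
        · exact .inr ⟨hu, hv⟩
    rcases hsplit with h | h
    · rcases h hx with h | ⟨-, u, hu, hux⟩
      · exact zero_ne_one (h.symm.trans hpx)
      · exact hxC u hu hux
    · exact zero_ne_one (hpb.symm.trans (h (hBX b hb)))

end Components

/-- For a bag `X_t` of an atomic tree decomposition of a finite two-connected graph, the
union `U` of the vertex sets of the geodesic cycles meeting `X_t` contains `X_t`, and the
subgraph of `G` induced by `U` is connected. -/
theorem atomic_geodesicCycles_cover_connected {V ι : Type} [Fintype V] [Fintype ι]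
    (G : SimpleGraph V) (hG : TwoConnected G)
    (D : TreeDecomp G ι) (hD : D.IsAtomic) (t : ι)
    (U : Set V)
    (hU : U = ⋃ H ∈ {H : G.Subgraph | IsCycleSubgraph H ∧ IsGeodesicSubgraph H ∧
        ∃ v ∈ D.bag t, v ∈ H.verts}, Subgraph.verts H) :
    D.bag t ⊆ U ∧ (G.induce U).Connected := by
  classical
  have hne : Nonempty V := hG.1.nonempty
  have hmem : ∀ v, v ∈ U ↔ ∃ H : G.Subgraph, (IsCycleSubgraph H ∧ IsGeodesicSubgraph H ∧
      ∃ v ∈ D.bag t, v ∈ H.verts) ∧ v ∈ H.verts := by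
    intro v
    simp only [hU, Set.mem_iUnion, Set.mem_ofPred_eq, exists_prop]
  have hXU : D.bag t ⊆ U := by
    intro v hv
    obtain ⟨H, hc, hg, hvH⟩ := hG.exists_geodesic_cycle_mem v
    exact (hmem v).2 ⟨H, ⟨hc, hg, v, hv, hvH⟩, hvH⟩
  have hsub : ∀ H : G.Subgraph, IsCycleSubgraph H → IsGeodesicSubgraph H →
      ∀ x ∈ D.bag t, x ∈ H.verts → H.verts ⊆ U := fun H hc hg x hx hxH y hy =>
    (hmem y).2 ⟨H, ⟨hc, hg, x, hx, hxH⟩, hy⟩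
  have hreach : ∀ H : G.Subgraph, IsCycleSubgraph H → ∀ hHU : H.verts ⊆ U,
      ∀ y z (hy : y ∈ H.verts) (hz : z ∈ H.verts),
        (G.induce U).Reachable ⟨y, hHU hy⟩ ⟨z, hHU hz⟩ := by
    intro H hc hHU y z hy hz
    let φ : H.coe →g G.induce U := ⟨fun k => ⟨k.1, hHU k.2⟩, fun h => H.adj_sub h⟩
    exact (hc.1.coe.preconnected ⟨y, hy⟩ ⟨z, hz⟩).map φ
  refine ⟨hXU, (connected_iff _).2 ⟨?_, (hD.bag_nonempty t).mono hXU |>.to_subtype⟩⟩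
  have hbag : ∀ y : U, ∃ x, ∃ hx : x ∈ D.bag t, (G.induce U).Reachable y ⟨x, hXU hx⟩ := by
    rintro ⟨y, hy⟩
    obtain ⟨H, ⟨hc, hg, x, hx, hxH⟩, hyH⟩ := (hmem y).1 hy
    exact ⟨x, hx, hreach H hc (hsub H hc hg x hx hxH) y x hyH hxH⟩
  intro y z
  by_contra hyz
  obtain ⟨a₀, ha₀, hya₀⟩ := hbag y
  obtain ⟨b₀, hb₀, hzb₀⟩ := hbag z
  let A : Set V := {x | ∃ hx : x ∈ D.bag t, (G.induce U).Reachable y ⟨x, hXU hx⟩}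
  have hAX : A ⊆ D.bag t := fun x hx => hx.1
  obtain ⟨a, ha, b, hb, hab⟩ := hD.exists_adj_of_partition hG.1 t (A := A) (B := D.bag t \ A)
    ⟨a₀, ha₀, hya₀⟩ ⟨b₀, hb₀, fun h => hyz (h.2.trans hzb₀.symm)⟩ Set.disjoint_sdiff_right
    (Set.union_sdiff_cancel hAX)
    (fun H hc hg a ha b hb haH hbH => hb.2 ⟨hb.1, ha.2.trans
      (hreach H hc (hsub H hc hg a ha.1 haH) a b haH hbH)⟩)
  exact hb.2 ⟨hb.1, ha.2.trans (Adj.reachable (G := G.induce U) hab)⟩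
end

section
/- If a finite connected graph G admits a tree decomposition of length at most λ, then G is λ-hyperbolic; equivalently, δ(G) ≤ tl(G) for every finite connected graph G. -/
open SimpleGraph
/-- Two paths meeting only at their common endpoint concatenate to a path. -/
theorem SimpleGraph.Walk.IsPath.append_of_support_inter {V : Type*} {G : SimpleGraph V}
    {u v w : V} {p : G.Walk u v} {q : G.Walk v w} (hp : p.IsPath) (hq : q.IsPath)
    (h : ∀ x ∈ p.support, x ∈ q.support → x = v) : (p.append q).IsPath := by
  rw [Walk.isPath_def, Walk.support_append]
  have hq' := hq.support_nodup
  rw [← Walk.cons_tail_support, List.nodup_cons] at hq'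
  refine List.Nodup.append hp.support_nodup hq'.2 fun x hx hx' => hq'.1 ?_
  exact h x hx (List.mem_of_mem_tail hx') ▸ hx'

/-- Every walk from `a` to `b` passes through `s`. -/
def SimpleGraph.Separates {V : Type*} (G : SimpleGraph V) (s a b : V) : Prop :=
  ∀ p : G.Walk a b, s ∈ p.support

namespace SimpleGraph

variable {V : Type*} {G : SimpleGraph V} {s a b c : V}

theorem Separates.symm (h : G.Separates s a b) : G.Separates s b a := fun p => by
  simpa using h p.reverse

theorem Separates.or (h : G.Separates s a b) (c : V) :
    G.Separates s c a ∨ G.Separates s c b := by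
  by_contra! hc
  simp only [Separates, not_forall] at hc
  obtain ⟨⟨p, hp⟩, q, hq⟩ := hc
  have := h (p.reverse.append q)
  simp_all [Walk.mem_support_append_iff]

theorem IsAcyclic.separates_of_isPath (hG : G.IsAcyclic) {p : G.Walk a b} (hp : p.IsPath)
    (hs : s ∈ p.support) : G.Separates s a b := fun q => by
  classical
  have h : p = q.bypass := congrArg Subtype.val
    ((hG.subsingleton_path a b).elim ⟨p, hp⟩ ⟨_, q.bypass_isPath⟩)
  exact q.support_bypass_subset_support (h ▸ hs)

/-- Any three vertices of a tree have a median. -/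
theorem IsTree.exists_median (hG : G.IsTree) (a b c : V) :
    ∃ s, G.Separates s a b ∧ G.Separates s a c ∧ G.Separates s b c := by
  classical
  obtain ⟨p, hp⟩ := hG.connected.exists_isPath a b
  obtain ⟨q, hq⟩ := hG.connected.exists_isPath c a
  obtain ⟨s, hs, hsq, h⟩ := q.exists_mem_support_forall_mem_support_imp_eq p.support.toFinset
    ⟨a, by simp⟩
  rw [List.mem_toFinset] at hs
  have hq' := hq.takeUntil hsq
  refine ⟨s, hG.isAcyclic.separates_of_isPath hp hs, ?_, ?_⟩
  · refine (hG.isAcyclic.separates_of_isPath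
      (hq'.append_of_support_inter (hp.takeUntil hs).reverse fun x hx hx' => ?_) ?_).symm
    · exact h x (by simpa using p.support_takeUntil_subset_support hs (by simpa using hx')) hx
    · simp
  · refine (hG.isAcyclic.separates_of_isPath
      (hq'.append_of_support_inter (hp.dropUntil hs) fun x hx hx' => ?_) ?_).symm
    · exact h x (by simpa using p.support_dropUntil_subset_support hs hx') hx
    · simp

end SimpleGraph

namespace TreeDecomp

variable {V ι : Type} {G : SimpleGraph V}

theorem exists_walk_of_mem_bag (D : TreeDecomp G ι) {v : V} {i j : ι} (hi : v ∈ D.bag i)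
    (hj : v ∈ D.bag j) : ∃ p : D.tree.Walk i j, ∀ k ∈ p.support, v ∈ D.bag k := by
  obtain ⟨p⟩ := (D.bagConn v).preconnected ⟨i, hi⟩ ⟨j, hj⟩
  refine ⟨p.map (Embedding.induce _).toHom, fun k hk => ?_⟩
  obtain ⟨x, -, rfl⟩ := List.mem_map.mp (Walk.support_map _ p ▸ hk)
  exact x.2

theorem exists_mem_bag_mem_support (D : TreeDecomp G ι) {s : ι} {u v : V} (p : G.Walk u v) :
    ∀ {i j : ι}, u ∈ D.bag i → v ∈ D.bag j → D.tree.Separates s i j →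
      ∃ x ∈ p.support, x ∈ D.bag s := by
  induction p with
  | nil =>
    intro i j hi hj h
    obtain ⟨q, hq⟩ := D.exists_walk_of_mem_bag hi hj
    exact ⟨_, by simp, hq s (h q)⟩
  | cons e p ih =>
    intro i j hi hj h
    obtain ⟨k, hk, hk'⟩ := D.coversEdge e
    rcases h.or k with h | h
    · obtain ⟨q, hq⟩ := D.exists_walk_of_mem_bag hk hi
      exact ⟨_, by simp, hq s (h q)⟩
    · obtain ⟨x, hx, hx'⟩ := ih hk' hj h
      exact ⟨x, by simp [hx], hx'⟩

theorem exists_mem_bag_dist_add_dist (D : TreeDecomp G ι) (hG : G.Connected) {s i j : ι}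
    {u v : V} (hi : u ∈ D.bag i) (hj : v ∈ D.bag j) (h : D.tree.Separates s i j) :
    ∃ x ∈ D.bag s, G.dist u x + G.dist x v ≤ G.dist u v := by
  classical
  obtain ⟨p, hp⟩ := hG.exists_walk_length_eq_dist u v
  obtain ⟨x, hx, hxs⟩ := D.exists_mem_bag_mem_support p hi hj h
  refine ⟨x, hxs, ?_⟩
  rw [← hp, ← p.take_spec hx, Walk.length_append]
  exact add_le_add (dist_le _) (dist_le _)

theorem dist_le_length [Finite V] (D : TreeDecomp G ι) {i : ι} {x y : V} (hx : x ∈ D.bag i)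
    (hy : y ∈ D.bag i) : G.dist x y ≤ D.length := by
  refine le_csSup (Set.Finite.bddAbove ?_) ⟨i, x, y, hx, hy, rfl⟩
  refine (Set.finite_range fun p : V × V => G.dist p.1 p.2).subset ?_
  rintro _ ⟨_, x, y, -, -, rfl⟩
  exact ⟨(x, y), rfl⟩

theorem dist_add_dist_le_of_separates [Finite V] (D : TreeDecomp G ι) (hG : G.Connected)
    {s i j k l : ι} {w x y z : V} (hw : w ∈ D.bag i) (hx : x ∈ D.bag j) (hy : y ∈ D.bag k)
    (hz : z ∈ D.bag l) (hwy : D.tree.Separates s i k) (hxz : D.tree.Separates s j l) :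
    G.dist w x + G.dist y z ≤ G.dist w y + G.dist x z + 2 * D.length := by
  obtain ⟨p, hp, hwpy⟩ := D.exists_mem_bag_dist_add_dist hG hw hy hwy
  obtain ⟨q, hq, hxqz⟩ := D.exists_mem_bag_dist_add_dist hG hx hz hxz
  have hpq := D.dist_le_length hp hq
  have h₁ := hG.dist_triangle (u := w) (v := p) (w := x)
  have h₂ := hG.dist_triangle (u := p) (v := q) (w := x)
  have h₃ := hG.dist_triangle (u := y) (v := p) (w := z)
  have h₄ := hG.dist_triangle (u := p) (v := q) (w := z)
  rw [G.dist_comm (u := q) (v := x)] at h₂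
  rw [G.dist_comm (u := y) (v := p)] at h₃
  omega

/-- The four-point condition holds with constant the length of a tree decomposition. -/
theorem dist_add_dist_le [Finite V] (D : TreeDecomp G ι) (hG : G.Connected) (w x y z : V) :
    G.dist w x + G.dist y z ≤
      max (G.dist w y + G.dist x z) (G.dist w z + G.dist x y) + 2 * D.length := by
  obtain ⟨i, hw⟩ := D.covers w
  obtain ⟨j, hx⟩ := D.covers x
  obtain ⟨k, hy⟩ := D.covers y
  obtain ⟨l, hz⟩ := D.covers z
  obtain ⟨s, hwy, hwz, hyz⟩ := D.isTree.exists_median i k l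
  rcases hyz.or j with h | h
  · have := D.dist_add_dist_le_of_separates hG hw hx hz hy hwz h
    rw [G.dist_comm (u := z) (v := y)] at this
    omega
  · have := D.dist_add_dist_le_of_separates hG hw hx hy hz hwy h
    omega

theorem hyperbolicity_le [Finite V] (D : TreeDecomp G ι) (hG : G.Connected) :
    hyperbolicity G ≤ (D.length : ℝ) :=
  csInf_le ⟨0, fun _ h => h.1⟩ ⟨by positivity, fun w x y z => mod_cast
    D.dist_add_dist_le hG w x y z⟩

/-- The tree decomposition with a single bag. -/
def singleBag (G : SimpleGraph V) : TreeDecomp G Unit where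
  tree := ⊥
  isTree := .of_subsingleton
  bag _ := Set.univ
  covers _ := ⟨(), Set.mem_univ _⟩
  coversEdge _ _ _ := ⟨(), Set.mem_univ _, Set.mem_univ _⟩
  bagConn v :=
    have : Nonempty {_i : Unit | v ∈ (Set.univ : Set V)} := ⟨⟨(), Set.mem_univ v⟩⟩
    ⟨.of_subsingleton⟩

end TreeDecomp

/-- If a finite connected graph admits a tree decomposition of length at most `λ`, then it
is `λ`-hyperbolic; equivalently `δ(G) ≤ tl(G)`. -/
theorem hyperbolicity_le_length {V : Type} [Fintype V]
    (G : SimpleGraph V) (hG : G.Connected) :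
    (∀ (lam : ℕ) (ι : Type) [Fintype ι] (D : TreeDecomp G ι),
      D.length ≤ lam → hyperbolicity G ≤ (lam : ℝ)) ∧
    hyperbolicity G ≤ (treelength G : ℝ) := by
  refine ⟨fun lam ι _ D h => (D.hyperbolicity_le hG).trans (mod_cast h), ?_⟩
  obtain ⟨ι, _, D, hD⟩ : treelength G ∈
      {l | ∃ (ι : Type) (_ : Fintype ι) (D : TreeDecomp G ι), D.length = l} :=
    Nat.sInf_mem ⟨_, Unit, inferInstance, TreeDecomp.singleBag G, rfl⟩
  exact hD ▸ D.hyperbolicity_le hG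
end
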